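/- Let q be a prime power of characteristic p, let n be an integer with 3 ≤ n ≤ p, let e be a divisor of q−1, and let l be a prime divisor of q−1 not dividing e. For positive integers j, k with 1 ≤ j, k ≤ n define l_{jk} = l if j = k and l_{jk} = 1 otherwise. Then, for each j ∈ {1, …, n}, |N(l_{j1}e, …, l_{jn}e) − θ(l) N_n(e)| ≤ (1 − 1/l) · θ(e)^n (n−1) W(e)^n √q. -/

import Mathlib

open Finset

/-- An element `g` of a finite field is primitive if it generates the multiplicative
group of nonzero elements, i.e. every nonzero element is a power of `g`. -/
def IsPrimitiveElem {F : Type*} [Field F] (g : F) : Prop :=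
  ∀ x : F, x ≠ 0 → ∃ k : ℕ, g ^ k = x

/-- The field `F` contains `n` consecutive distinct primitive elements: there is `g`
such that `g, g+1, …, g+n-1` are `n` distinct primitive elements. -/
def HasConsecutivePrimitives (F : Type*) [Field F] (n : ℕ) : Prop :=
  ∃ g : F, (∀ k : ℕ, k < n → IsPrimitiveElem (g + (k : F))) ∧
    ∀ i : ℕ, i < n → ∀ j : ℕ, j < n → g + (i : F) = g + (j : F) → i = j

/-- A nonzero element `g` is `e`-free if `g = h ^ d` with `d ∣ e` forces `d = 1`. -/
def EFree {F : Type*} [Field F] (e : ℕ) (g : F) : Prop :=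
  g ≠ 0 ∧ ∀ (h : F) (d : ℕ), d ∣ e → g = h ^ d → d = 1

/-- `Ncount F n e` is the number `N(e₁, …, eₙ)` of `g ∈ F` such that `g + k - 1`
is `eₖ`-free for each `k = 1, …, n`. -/
noncomputable def Ncount (F : Type*) [Field F] (n : ℕ) (e : Fin n → ℕ) : ℕ :=
  Nat.card {g : F // ∀ k : Fin n, EFree (e k) (g + ((k : ℕ) : F))}

/-- `Nn F n e = N(e, …, e)` counts `g ∈ F` with `g, g+1, …, g+n-1` all `e`-free. -/
noncomputable def Nn (F : Type*) [Field F] (n e : ℕ) : ℕ :=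
  Ncount F n (fun _ => e)

/-- `θ(m) = ∏_{ℓ ∣ m, ℓ prime} (1 - 1/ℓ)`. -/
noncomputable def theta (m : ℕ) : ℝ :=
  ∏ l ∈ m.primeFactors, (1 - 1 / (l : ℝ))

/-- `W(m) = 2^{ω(m)}`, the number of squarefree divisors of `m`. -/
def W (m : ℕ) : ℕ := 2 ^ m.primeFactors.card

section Stepanov

open Polynomial

lemma exists_multiset_prod_eq_mul_pow {k Ω : Type*} [Field k] [Field Ω] [Algebra k Ω] {d : ℕ}
    (hd : 0 < d) {ζ : k} (hζ : IsPrimitiveRoot ζ d) {y : Ω} (hy : y ≠ 0) (s : Multiset Ω)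
    (hs : ∀ r ∈ s, r ^ d = y ^ d) :
    ∃ c : k, c ≠ 0 ∧ s.prod = algebraMap k Ω c * y ^ Multiset.card s := by
  induction s using Multiset.induction_on with
  | empty => exact ⟨1, one_ne_zero, by simp⟩
  | cons r s ih =>
    obtain ⟨c, hc, h⟩ := ih fun x hx => hs x (Multiset.mem_cons_of_mem hx)
    have hr := hs r (Multiset.mem_cons_self r s)
    have : NeZero d := ⟨hd.ne'⟩
    have h1 : (r / y) ^ d = 1 := by rw [div_pow, hr, div_self (pow_ne_zero _ hy)]
    obtain ⟨i, -, hi⟩ :=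
      (hζ.map_of_injective (algebraMap k Ω).injective).eq_pow_of_pow_eq_one h1
    refine ⟨ζ ^ i * c, mul_ne_zero (pow_ne_zero _ (hζ.ne_zero hd.ne')) hc, ?_⟩
    have : r = algebraMap k Ω ζ ^ i * y := by rw [hi, div_mul_cancel₀ _ hy]
    rw [Multiset.prod_cons, h, Multiset.card_cons, this, map_mul, map_pow]
    ring

/-- If a `d`-th root of `a` has degree less than `d` over a field containing the `d`-th roots of
unity, then `a` is a proper power. -/
lemma exists_pow_eq_of_aeval_eq_zero {k Ω : Type*} [Field k] [Field Ω] [Algebra k Ω] {d : ℕ}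
    {ζ : k} (hζ : IsPrimitiveRoot ζ d) {a : k} (ha : a ≠ 0) {y : Ω}
    (hy : y ^ d = algebraMap k Ω a) {P : k[X]} (hP : P ≠ 0) (hdeg : P.natDegree < d)
    (hroot : aeval y P = 0) : ∃ t, t ∣ d ∧ 1 < t ∧ ∃ b : k, b ^ t = a := by
  have hd : 0 < d := by omega
  have hy0 : y ≠ 0 := by
    rintro rfl
    rw [zero_pow hd.ne'] at hy
    exact ha ((map_eq_zero _).1 hy.symm)
  have hint : IsIntegral k y := IsAlgebraic.isIntegral ⟨P, hP, hroot⟩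
  have hdvd : minpoly k y ∣ X ^ d - C a := minpoly.dvd k y (by simp [hy])
  have hspl : ((X ^ d - C a).map (algebraMap k Ω)).Splits := by
    have := X_pow_sub_C_splits_of_isPrimitiveRoot
      (hζ.map_of_injective (algebraMap k Ω).injective) hy
    simpa using this
  have hne : (X ^ d - C a : k[X]) ≠ 0 := X_pow_sub_C_ne_zero hd a
  have hspl' : ((minpoly k y).map (algebraMap k Ω)).Splits :=
    hspl.of_dvd (Polynomial.map_ne_zero hne) (Polynomial.map_dvd _ hdvd)
  set m := (minpoly k y).natDegree with hm
  have hm0 : 0 < m := minpoly.natDegree_pos hint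
  have hmd : m < d := (natDegree_le_of_dvd (minpoly.dvd k y hroot) hP).trans_lt hdeg
  obtain ⟨c, hc, hprod⟩ := exists_multiset_prod_eq_mul_pow hd hζ hy0
    ((minpoly k y).map (algebraMap k Ω)).roots (by
      intro r hr
      have h1 := (mem_roots'.1 hr).2
      have h2 : aeval r (X ^ d - C a) = 0 := by
        obtain ⟨w, hw⟩ := hdvd
        rw [hw, map_mul]
        simp only [IsRoot.def, eval_map_algebraMap] at h1
        rw [h1, zero_mul]
      rw [hy]
      simpa [sub_eq_zero] using h2)
  have hcard : Multiset.card ((minpoly k y).map (algebraMap k Ω)).roots = m := by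
    rw [← hspl'.natDegree_eq_card_roots, natDegree_map]
  have hcoeff := hspl'.coeff_zero_eq_prod_roots_of_monic ((minpoly.monic hint).map _)
  rw [hprod, hcard, natDegree_map, coeff_map, ← hm] at hcoeff
  obtain ⟨b, hb⟩ : ∃ b : k, y ^ m = algebraMap k Ω b := by
    refine ⟨(minpoly k y).coeff 0 / ((-1) ^ m * c), ?_⟩
    rw [map_div₀, hcoeff]
    have : algebraMap k Ω c ≠ 0 := by simpa using hc
    simp only [map_mul, map_pow, map_neg, map_one]
    field_simp
  have hg : Nat.gcd m d ∣ d := Nat.gcd_dvd_right m d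
  have hgle : Nat.gcd m d ≤ m := Nat.gcd_le_left _ hm0
  have hgpos : 0 < Nat.gcd m d := Nat.gcd_pos_of_pos_left _ hm0
  obtain ⟨t, ht⟩ := hg
  refine ⟨t, ⟨_, by rw [mul_comm]; exact ht⟩, ?_, b ^ (Nat.gcdA m d) * a ^ (Nat.gcdB m d), ?_⟩
  · by_contra h
    have : t ≤ 1 := by omega
    nlinarith
  · apply (algebraMap k Ω).injective
    have : y ^ Nat.gcd m d
        = algebraMap k Ω (b ^ (Nat.gcdA m d) * a ^ (Nat.gcdB m d)) := by
      rw [map_mul, map_zpow₀, map_zpow₀, ← hb, ← hy, ← zpow_natCast, ← zpow_natCast,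
        ← zpow_natCast, ← zpow_mul, ← zpow_mul, ← zpow_add₀ hy0, Nat.gcd_eq_gcd_ab]
    rw [map_pow, ← this, ← pow_mul, ← ht, hy]

/-- `f` is not a constant times a `t`-th power of a rational function, for every `1 < t ∣ d`. -/
def NotProperPower {K : Type*} [Field K] (d : ℕ) (f : K[X]) : Prop :=
  ∀ t, t ∣ d → 1 < t → ∀ (u v : K[X]) (κ : K), v ≠ 0 → κ ≠ 0 → u ^ t * f ≠ C κ * v ^ t

lemma coeff_natDegree_mul_le {K : Type*} [Field K] {P Q : K[X][X]} {a b : ℕ}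
    (hP : ∀ k, (P.coeff k).natDegree ≤ a) (hQ : ∀ k, (Q.coeff k).natDegree ≤ b) (k : ℕ) :
    ((P * Q).coeff k).natDegree ≤ a + b := by
  rw [coeff_mul]
  refine natDegree_sum_le_of_forall_le _ _ fun x _ => ?_
  exact natDegree_mul_le.trans (add_le_add (hP _) (hQ _))

lemma coeff_natDegree_prod_le {K : Type*} [Field K] {P : ℕ → K[X][X]} {a : ℕ}
    (hP : ∀ i k, ((P i).coeff k).natDegree ≤ a) (d k : ℕ) :
    ((∏ i ∈ range d, P i).coeff k).natDegree ≤ d * a := by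
  induction d generalizing k with
  | zero => simp [coeff_one]; split_ifs <;> simp
  | succ d ih =>
    rw [prod_range_succ, add_mul, one_mul]
    exact coeff_natDegree_mul_le ih (hP d) k

/-- The norm `∏_{ζ ∈ μ_d} P (ζ Z)` is a polynomial in `Z ^ d`. -/
lemma exists_expand_eq_prod_comp {K : Type*} [Field K] {d : ℕ} {ζ : K}
    (hζ : IsPrimitiveRoot ζ d) (hd : 0 < d) (P : K[X][X]) :
    ∃ M : K[X][X], ∏ k ∈ range d, P.comp (C (C (ζ ^ k)) * X) = expand K[X] d M := by
  set N := ∏ k ∈ range d, P.comp (C (C (ζ ^ k)) * X) with hN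
  refine ⟨contract d N, ?_⟩
  have hinv : N.comp (C (C ζ) * X) = N := by
    have h1 : N.comp (C (C ζ) * X) = ∏ k ∈ range d, P.comp (C (C (ζ ^ (k + 1))) * X) := by
      rw [hN, ← coe_compRingHom_apply, map_prod]
      refine prod_congr rfl fun k _ => ?_
      rw [coe_compRingHom_apply, comp_assoc]
      congr 1
      simp [pow_succ, mul_assoc]
    rw [h1, hN]
    obtain ⟨d, rfl⟩ : ∃ e, d = e + 1 := ⟨d - 1, by omega⟩
    rw [prod_range_succ, prod_range_succ' (fun k => P.comp (C (C (ζ ^ k)) * X)), hζ.pow_eq_one,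
      pow_zero]
  ext1 k
  rw [coeff_expand hd]
  split_ifs with hk
  · rw [coeff_contract hd.ne', Nat.div_mul_cancel hk]
  · have := congrArg (fun Q => Q.coeff k) hinv
    simp only [comp_C_mul_X_coeff] at this
    by_contra h
    rw [← C_pow] at this
    have h4 : C (ζ ^ k) = (1 : K[X]) := mul_left_cancel₀ h (by rw [this, mul_one])
    rw [← C_1, C_inj] at h4
    exact hk (hζ.dvd_of_pow_eq_one k h4)

lemma eq_zero_of_eval_div_eq_zero {K : Type*} [Field K] {d : ℕ} {ζ : K}
    (hζ : IsPrimitiveRoot ζ d) (hd : 0 < d) {f : K[X]} (hf0 : f ≠ 0) (hf : NotProperPower d f)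
    {κ : K} (hκ : κ ≠ 0) {P M : K[X][X]} (hP : P.degree < d)
    (hM : ∏ k ∈ range d, P.comp (C (C (ζ ^ k)) * X) = expand K[X] d M)
    (h0 : M.eval₂ (algebraMap K[X] (FractionRing K[X]))
      (algebraMap K[X] (FractionRing K[X]) (C κ) / algebraMap K[X] (FractionRing K[X]) f) = 0) :
    P = 0 := by
  by_contra hP0
  set k := FractionRing K[X]
  set φ := algebraMap K[X] k
  have hφ : Function.Injective φ := IsFractionRing.injective K[X] k
  let Ω := AlgebraicClosure k
  set ψ := (algebraMap k Ω).comp φ with hψ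
  set a : k := φ (C κ) / φ f
  have hfk : φ f ≠ 0 := by simpa using hφ.ne hf0
  have hκk : φ (C κ) ≠ 0 := by simpa using hφ.ne (C_ne_zero.2 hκ)
  have ha : a ≠ 0 := div_ne_zero hκk hfk
  obtain ⟨y, hy⟩ := IsAlgClosed.exists_pow_nat_eq (algebraMap k Ω a) hd
  have h1 : (expand K[X] d M).eval₂ ψ y = 0 := by
    rw [expand_eq_comp_X_pow, eval₂_comp, eval₂_pow, eval₂_X, hy, hψ, ← hom_eval₂, h0, map_zero]
  rw [← hM, eval₂_finsetProd, prod_eq_zero_iff] at h1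
  obtain ⟨i, -, hi⟩ := h1
  rw [eval₂_comp] at hi
  simp only [eval₂_mul, eval₂_C, eval₂_X] at hi
  have hζk : IsPrimitiveRoot (φ (C ζ)) d := hζ.map_of_injective (f := φ.comp C)
    (hφ.comp C_injective)
  have hy' : (ψ (C (ζ ^ i)) * y) ^ d = algebraMap k Ω a := by
    rw [mul_pow, hy, ← map_pow, ← map_pow, ← pow_mul, mul_comm i, pow_mul, hζ.pow_eq_one]
    simp
  obtain ⟨t, htd, ht1, b, hb⟩ := exists_pow_eq_of_aeval_eq_zero hζk ha hy' (P := P.map φ)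
    ((Polynomial.map_ne_zero_iff hφ).2 hP0)
    (by rw [natDegree_map_eq_of_injective hφ]; exact (natDegree_lt_iff_degree_lt hP0).2 hP)
    (by rw [aeval_def, eval₂_map]; exact hi)
  obtain ⟨u, v, hv, rfl⟩ := IsFractionRing.div_surjective (A := K[X]) b
  have hv0 : v ≠ 0 := nonZeroDivisors.ne_zero hv
  have hvk : φ v ≠ 0 := by simpa using hφ.ne hv0
  refine hf t htd ht1 u v κ hv0 hκ (hφ ?_)
  rw [map_mul, map_mul, map_pow, map_pow]
  rw [div_pow] at hb
  exact (div_eq_div_iff (pow_ne_zero _ hvk) hfk).1 hb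

lemma eq_zero_of_X_pow_dvd {K : Type*} [Field K] (p : ℕ) [ExpChar K p] {d s E A : ℕ} {ζ : K}
    (hζ : IsPrimitiveRoot ζ d) (hd : 0 < d) (hR : p ^ s = d * E + 1) {f : K[X]}
    (hf0 : f.eval 0 ≠ 0) (hf : NotProperPower d f) {S : ℕ → K[X]}
    (hS : ∀ i, (S i).natDegree ≤ A) (hA : d * A + d * f.natDegree < p ^ s)
    (hdvd : X ^ p ^ s ∣ ∑ i ∈ range d, S i * f ^ (i * E)) : ∀ i < d, S i = 0 := by
  have hf00 : f ≠ 0 := by rintro rfl; simp at hf0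
  set P : K[X][X] := ∑ i ∈ range d, C (S i) * X ^ i with hPdef
  have hPc : ∀ k, P.coeff k = if k < d then S k else 0 := by
    intro k
    simp [hPdef, coeff_C_mul, coeff_X_pow]
  suffices P = 0 by
    intro i hi
    have := hPc i
    rw [if_pos hi, ‹P = 0›, coeff_zero] at this
    exact this.symm
  obtain ⟨M, hM⟩ := exists_expand_eq_prod_comp hζ hd P
  set κ : K := f.eval 0 ^ p ^ s
  have hκ : κ ≠ 0 := pow_ne_zero _ hf0
  have hPdeg : P.degree < d := by
    rw [degree_lt_iff_coeff_zero]
    intro m hm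
    rw [hPc, if_neg (by omega)]
  refine eq_zero_of_eval_div_eq_zero hζ hd hf00 hf hκ hPdeg hM ?_
  have hMdeg : M.natDegree ≤ d := by
    have h1 : (expand K[X] d M).natDegree ≤ ∑ _k ∈ range d, d := by
      rw [← hM]
      refine (natDegree_prod_le _ _).trans (sum_le_sum fun k _ => ?_)
      refine natDegree_comp_le.trans ?_
      have h2 : P.natDegree ≤ d := natDegree_le_of_degree_le hPdeg.le
      have h3 : (C (C (ζ ^ k)) * X : K[X][X]).natDegree ≤ 1 :=
        (natDegree_C_mul_le _ _).trans natDegree_X_le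
      nlinarith
    rw [natDegree_expand, sum_const, card_range, smul_eq_mul] at h1
    exact Nat.le_of_mul_le_mul_right h1 hd
  have hMc : ∀ k, (M.coeff k).natDegree ≤ d * A := by
    intro k
    have h1 := coeff_natDegree_prod_le (P := fun k => P.comp (C (C (ζ ^ k)) * X)) (a := A) (by
      intro i j
      rw [comp_C_mul_X_coeff, ← C_pow]
      refine (natDegree_mul_C_le _ _).trans ?_
      rw [hPc]
      split_ifs
      · exact hS _
      · simp) d (k * d)
    rwa [hM, coeff_expand_mul hd] at h1
  have hPg : P.eval (f ^ E) = ∑ i ∈ range d, S i * f ^ (i * E) := by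
    simp [hPdef, eval_finsetSum, ← pow_mul, mul_comm E]
  have hMg : X ^ p ^ s ∣ M.eval ((f ^ E) ^ d) := by
    rw [← expand_eval, ← hM, eval_prod]
    refine (hdvd.trans ?_).trans (dvd_prod_of_mem _ (mem_range.2 hd))
    simp [hPg]
  have hfR : X ^ p ^ s ∣ f ^ p ^ s - C κ := by
    have h1 : (X : K[X]) ∣ f - C (f.eval 0) := by
      have h := X_sub_C_dvd_sub_C_eval (a := (0 : K)) (p := f)
      simpa using h
    have h2 := pow_dvd_pow_of_dvd h1 (p ^ s)
    rwa [sub_pow_expChar_pow, ← C_pow] at h2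
  set Q : K[X] := ∑ k ∈ range (d + 1), M.coeff k * f ^ (d - k) * C κ ^ k with hQ
  have hQ0 : Q = 0 := by
    refine eq_zero_of_dvd_of_natDegree_lt (p := X ^ p ^ s) ?_ ?_
    · have h1 : X ^ p ^ s ∣ f ^ d * M.eval ((f ^ E) ^ d) - Q := by
        rw [eval_eq_sum_range' (Nat.lt_succ_of_le hMdeg), mul_sum, hQ, ← sum_sub_distrib]
        refine dvd_sum fun k hk => ?_
        have hk' : k ≤ d := by simpa [Nat.lt_succ_iff] using hk
        have h2 : f ^ d * (M.coeff k * ((f ^ E) ^ d) ^ k)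
            = M.coeff k * f ^ (d - k) * (f ^ p ^ s) ^ k := by
          have : f ^ d = f ^ (d - k) * f ^ k := by rw [← pow_add, Nat.sub_add_cancel hk']
          rw [this, hR, pow_succ f, mul_pow, mul_comm d, pow_mul f E d]
          ring
        rw [h2, ← mul_sub]
        exact Dvd.dvd.mul_left (hfR.trans (sub_dvd_pow_sub_pow _ _ _)) _
      simpa using (Dvd.dvd.mul_left hMg (f ^ d)).sub h1
    · rw [natDegree_X_pow]
      refine lt_of_le_of_lt ?_ hA
      refine natDegree_sum_le_of_forall_le _ _ fun k hk => ?_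
      rw [← C_pow]
      refine (natDegree_mul_C_le _ _).trans (natDegree_mul_le.trans ?_)
      refine add_le_add (hMc k) (natDegree_pow_le.trans ?_)
      exact Nat.mul_le_mul_right _ (Nat.sub_le _ _)
  have hfk : algebraMap K[X] (FractionRing K[X]) f ≠ 0 := by
    simpa using (IsFractionRing.injective K[X] (FractionRing K[X])).ne hf00
  have h1 := congrArg (algebraMap K[X] (FractionRing K[X])) hQ0
  rw [map_zero, hQ, map_sum] at h1
  rw [eval₂_eq_sum_range' _ (Nat.lt_succ_of_le hMdeg)]
  refine (mul_eq_zero.1 ((?_ : algebraMap K[X] (FractionRing K[X]) f ^ d * _ = _).trans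
    h1)).resolve_left (pow_ne_zero _ hfk)
  rw [mul_sum]
  refine sum_congr rfl fun k hk => ?_
  have hk' : k ≤ d := by simpa [Nat.lt_succ_iff] using hk
  have : algebraMap K[X] (FractionRing K[X]) f ^ d =
    algebraMap K[X] (FractionRing K[X]) f ^ (d - k) * algebraMap K[X] (FractionRing K[X]) f ^ k := by
    rw [← pow_add, Nat.sub_add_cancel hk']
  clear_value κ
  simp only [this, map_mul, map_pow, div_pow]
  field_simp

lemma eq_zero_of_sum_eq_zero {K : Type*} [Field K] (p : ℕ) [ExpChar K p] {d s E A : ℕ} {ζ : K}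
    (hζ : IsPrimitiveRoot ζ d) (hd : 0 < d) (hR : p ^ s = d * E + 1) {f : K[X]}
    (hf0 : f.eval 0 ≠ 0) (hf : NotProperPower d f) (J : ℕ) {S : ℕ → ℕ → K[X]}
    (hS : ∀ i j, (S i j).natDegree ≤ A) (hA : d * A + d * f.natDegree < p ^ s)
    (h : ∑ i ∈ range d, ∑ j ∈ range J, S i j * X ^ (j * p ^ s) * f ^ (i * E) = 0) :
    ∀ i < d, ∀ j < J, S i j = 0 := by
  induction J generalizing S with
  | zero => intro i _ j hj; omega
  | succ J ih =>
    have hsplit : ∑ i ∈ range d, S i 0 * f ^ (i * E) + X ^ p ^ s *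
        ∑ i ∈ range d, ∑ j ∈ range J, S i (j + 1) * X ^ (j * p ^ s) * f ^ (i * E) = 0 := by
      rw [← h, mul_sum, ← sum_add_distrib]
      refine sum_congr rfl fun i _ => ?_
      rw [sum_range_succ', zero_mul, pow_zero, mul_one, add_comm, mul_sum]
      congr 1
      refine sum_congr rfl fun j _ => ?_
      ring
    have h0 : ∀ i < d, S i 0 = 0 := by
      refine eq_zero_of_X_pow_dvd p hζ hd hR hf0 hf (fun i => hS i 0) hA ?_
      exact (dvd_add_left (dvd_mul_right _ _)).1 (hsplit ▸ dvd_zero _)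
    rw [sum_eq_zero (fun i hi => by rw [h0 i (mem_range.1 hi), zero_mul]), zero_add] at hsplit
    have h1 := ih (S := fun i j => S i (j + 1)) (fun i j => hS i (j + 1))
      ((mul_eq_zero.1 hsplit).resolve_left (pow_ne_zero _ X_ne_zero))
    intro i hi j hj
    rcases j with _ | j
    · exact h0 i hi
    · exact h1 i hi j (by omega)

/-- More polynomials of degree less than `n` than the dimension satisfy a linear relation. -/
lemma exists_relation_of_natDegree_lt {K ι : Type*} [Field K] [Fintype ι] {n : ℕ} (v : ι → K[X])
    (hv : ∀ i, (v i).natDegree < n) (hn : n < Fintype.card ι) :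
    ∃ g : ι → K, ∑ i, g i • v i = 0 ∧ ∃ i, g i ≠ 0 := by
  have hmem : ∀ i, v i ∈ degreeLT K n := fun i =>
    mem_degreeLT.2 (degree_le_natDegree.trans_lt (by exact_mod_cast hv i))
  have hfin : Module.finrank K (degreeLT K n) = n := by
    rw [(degreeLTEquiv K n).finrank_eq, Module.finrank_fin_fun]
  have : Module.Finite K (degreeLT K n) := Module.Finite.equiv (degreeLTEquiv K n).symm
  have hdep : ¬ LinearIndependent K (fun i => (⟨v i, hmem i⟩ : degreeLT K n)) := fun h => by
    have := h.fintype_card_le_finrank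
    omega
  obtain ⟨g, hg, hi⟩ := Fintype.not_linearIndependent_iff.1 hdep
  refine ⟨g, ?_, hi⟩
  simpa using congrArg (degreeLT K n).subtype hg

/-- An elementary version of the Bombieri-Stepanov upper bound for the number of points of
`y ^ d = f x` lying over a fixed `d`-th power class. -/
lemma card_filter_pow_eq_le_aux {K : Type*} [Field K] [Fintype K] [DecidableEq K] (p : ℕ)
    [ExpChar K p] {d s E A J : ℕ} {ζ : K}
    (hζ : IsPrimitiveRoot ζ d) (hd : 0 < d) (hR : p ^ s = d * E + 1)
    (hK : Fintype.card K = p ^ s * p ^ s) {f : K[X]}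
    (hf0 : f.eval 0 ≠ 0) (hf : NotProperPower d f) {c : K} (hc : c ≠ 0)
    (hA : d * A + d * f.natDegree < p ^ s)
    (hdim : A * p ^ s + J + f.natDegree * p ^ s < d * (J * A)) :
    #{x : K | f.eval x ^ (E * p ^ s + E) = c} ≤ A + J * p ^ s + f.natDegree * p ^ s := by
  set D := f.natDegree with hD
  have hdE : d * E ≤ p ^ s := by omega
  have hfpow : ∀ i, i ≤ d → (f ^ (i * E)).natDegree ≤ D * p ^ s := by
    intro i hi
    refine natDegree_pow_le.trans ?_
    rw [mul_comm]
    exact Nat.mul_le_mul_left _ ((Nat.mul_le_mul_right _ hi).trans hdE)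
  obtain ⟨τ, hτ, ⟨i₀, j₀, a₀⟩, hne⟩ := exists_relation_of_natDegree_lt
    (n := A * p ^ s + J + D * p ^ s)
    (fun x : Fin d × Fin J × Fin A =>
      C (c ^ (x.1 : ℕ)) * (X ^ ((x.2.2 : ℕ) * p ^ s + (x.2.1 : ℕ)) * f ^ ((d - (x.1 : ℕ)) * E)))
    (by
      rintro ⟨i, j, a⟩
      refine (natDegree_C_mul_le _ _).trans_lt (natDegree_mul_le.trans_lt ?_)
      rw [natDegree_X_pow]
      refine Nat.add_lt_add_of_lt_of_le ?_ (hfpow _ (Nat.sub_le _ _))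
      exact Nat.add_lt_add_of_le_of_lt (Nat.mul_le_mul_right _ a.2.le) j.2)
    (by simpa using hdim)
  set S : ℕ → ℕ → K[X] := fun i j => if h : i < d ∧ j < J then
    ∑ a : Fin A, C (τ (⟨i, h.1⟩, ⟨j, h.2⟩, a) ^ p ^ s) * X ^ (a : ℕ) else 0 with hS
  have hSdeg : ∀ i j, (S i j).natDegree ≤ A := by
    intro i j
    simp only [hS]
    split_ifs with h
    · exact natDegree_sum_le_of_forall_le _ _ fun a _ =>
        (natDegree_C_mul_X_pow_le _ _).trans a.2.le
    · simp
  have hSfin : ∀ (i : Fin d) (j : Fin J),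
      S i j = ∑ a : Fin A, C (τ (i, j, a) ^ p ^ s) * X ^ (a : ℕ) := by
    intro i j
    simp only [hS]
    rw [dif_pos ⟨i.2, j.2⟩]
  set G : K[X] := ∑ i ∈ range d, ∑ j ∈ range J, S i j * X ^ (j * p ^ s) * f ^ (i * E) with hG
  have hG0 : G ≠ 0 := by
    intro h
    have h1 := eq_zero_of_sum_eq_zero p hζ hd hR hf0 hf J hSdeg hA h i₀ i₀.2 j₀ j₀.2
    rw [hSfin] at h1
    have h2 := congrArg (fun P => P.coeff a₀) h1
    simp only [finsetSum_coeff, coeff_C_mul_X_pow, coeff_zero] at h2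
    rw [sum_eq_single a₀ (fun b _ hb => if_neg fun h => hb (Fin.ext h.symm)) (by simp)] at h2
    rw [if_pos rfl] at h2
    exact hne (eq_zero_of_pow_eq_zero h2)
  have hGdeg : G.natDegree ≤ A + J * p ^ s + D * p ^ s := by
    refine natDegree_sum_le_of_forall_le _ _ fun i hi =>
      natDegree_sum_le_of_forall_le _ _ fun j hj => ?_
    refine natDegree_mul_le.trans (add_le_add (natDegree_mul_le.trans
      (add_le_add (hSdeg i j) ?_)) (hfpow _ (mem_range.1 hi).le))
    rw [natDegree_X_pow]
    exact Nat.mul_le_mul_right _ (mem_range.1 hj).le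
  have hroot : ∀ x : K, f.eval x ^ (E * p ^ s + E) = c → G.eval x = 0 := by
    intro x hx
    have hfx : f.eval x ≠ 0 := by
      intro h0
      rw [h0] at hx
      rcases Nat.eq_zero_or_pos E with hE | hE
      · have hc1 : c = 1 := by rw [← hx, hE]; simp
        have hp1 : p ^ s = 1 := by rw [hR, hE, mul_zero]
        rw [hp1] at hK
        have := Fintype.one_lt_card (α := K)
        omega
      · rw [zero_pow (by positivity)] at hx
        exact hc hx.symm
    have hfrob : ∀ z : K, (z ^ p ^ s) ^ p ^ s = z := by
      intro z
      rw [← pow_mul, ← hK, FiniteField.pow_card]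
    have hkey : f.eval x ^ (d * E) * G.eval x ^ p ^ s = 0 := by
      have hτx := congrArg (fun P => P.eval x) hτ
      simp only [eval_finsetSum, eval_zero, Fintype.sum_prod_type, eval_smul, smul_eq_mul,
        eval_mul, eval_C, eval_pow, eval_X] at hτx
      rw [← hτx, hG, ← Fin.sum_univ_eq_sum_range
        (fun i => ∑ j ∈ range J, S i j * X ^ (j * p ^ s) * f ^ (i * E)), eval_finsetSum,
        ← iterateFrobenius_def p s, map_sum, mul_sum]
      refine sum_congr rfl fun i _ => ?_
      rw [← Fin.sum_univ_eq_sum_range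
        (fun j => S i j * X ^ (j * p ^ s) * f ^ ((i : ℕ) * E)), eval_finsetSum, map_sum, mul_sum]
      refine sum_congr rfl fun j _ => ?_
      rw [hSfin, eval_mul, eval_mul, eval_finsetSum, map_mul, map_mul, map_sum, sum_mul, sum_mul,
        mul_sum]
      refine sum_congr rfl fun a _ => ?_
      simp only [eval_mul, eval_C, eval_pow, eval_X, map_mul, iterateFrobenius_def, hfrob]
      have h1 : (x ^ ((j : ℕ) * p ^ s)) ^ p ^ s = x ^ (j : ℕ) := by rw [pow_mul, hfrob]
      have h2 : f.eval x ^ (d * E) * (f.eval x ^ ((i : ℕ) * E)) ^ p ^ s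
          = c ^ (i : ℕ) * f.eval x ^ ((d - (i : ℕ)) * E) := by
        rw [← hx, ← pow_mul, ← pow_mul, ← pow_add, ← pow_add]
        congr 1
        obtain ⟨m, hm⟩ : ∃ m, d = m + i := ⟨d - i, by omega⟩
        rw [show d * E = (m + i) * E by rw [← hm], show d - (i : ℕ) = m by omega]
        ring
      rw [h1]
      calc _ = τ (i, j, a) * ((x ^ (a : ℕ)) ^ p ^ s * x ^ (j : ℕ)) *
            (f.eval x ^ (d * E) * (f.eval x ^ ((i : ℕ) * E)) ^ p ^ s) := by ring
        _ = _ := by rw [h2, pow_add, pow_mul]; ring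
    exact eq_zero_of_pow_eq_zero ((mul_eq_zero.1 hkey).resolve_left (pow_ne_zero _ hfx))
  calc _ ≤ #G.roots.toFinset := by
        refine card_le_card fun x hx => ?_
        rw [Multiset.mem_toFinset, mem_roots hG0]
        exact hroot x (by simpa using hx)
    _ ≤ _ := (Multiset.toFinset_card_le _).trans ((card_roots' G).trans hGdeg)

lemma card_filter_pow_eq_le {K : Type*} [Field K] [Fintype K] [DecidableEq K] (p : ℕ)
    [ExpChar K p] {d s E : ℕ} {ζ : K}
    (hζ : IsPrimitiveRoot ζ d) (hd : 0 < d) (hR : p ^ s = d * E + 1)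
    (hK : Fintype.card K = p ^ s * p ^ s) {f : K[X]}
    (hf0 : f.eval 0 ≠ 0) (hf : NotProperPower d f) {c : K} (hc : c ≠ 0)
    (hlarge : 4 * d * (f.natDegree + 3) < p ^ s) :
    d * #{x : K | f.eval x ^ (E * p ^ s + E) = c} ≤
      p ^ s * p ^ s + d * (9 * f.natDegree + 17) * p ^ s := by
  set D := f.natDegree
  set R := p ^ s with hRdef
  set A := R / (2 * d) with hAdef
  set J := E + 8 * (D + 2) with hJ
  have hAR : 2 * d * A ≤ R := Nat.mul_div_le R (2 * d)
  have hAR' : R < 2 * d * (A + 1) := Nat.lt_mul_div_succ R (by omega)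
  have hdD : d * D + d ≤ d * (D + 3) := by nlinarith
  have hA : d * A + d * D < R := by nlinarith
  have h8 : R ≤ 4 * d * A := by nlinarith
  have hdim : A * R + J + D * R < d * (J * A) := by
    have h1 : d * (J * A) = A * (d * E) + 2 * (D + 2) * (4 * d * A) := by rw [hJ]; ring
    have h2 : 2 * (D + 2) * R ≤ 2 * (D + 2) * (4 * d * A) := Nat.mul_le_mul_left _ h8
    have h3 : A * R = A * (d * E) + A := by rw [hR]; ring
    have h4 : E ≤ d * E := Nat.le_mul_of_pos_left _ hd
    have h5 : A ≤ 2 * d * A := Nat.le_mul_of_pos_left _ (by omega)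
    have h6 : D + 3 ≤ d * (D + 3) := Nat.le_mul_of_pos_left _ hd
    nlinarith
  have := card_filter_pow_eq_le_aux p hζ hd hR hK hf0 hf hc hA hdim
  calc d * _ ≤ d * (A + J * R + D * R) := Nat.mul_le_mul_left _ this
    _ ≤ _ := by
      have h7 : d * A ≤ d * R := Nat.mul_le_mul_left _ (by nlinarith)
      have h9 : d * E * R ≤ R * R := Nat.mul_le_mul_right _ (by omega)
      rw [hJ]
      nlinarith

lemma notProperPower_prod {K ι : Type*} [Field K] [Fintype ι] {b : ι → K}
    (hb : Function.Injective b) {c : ι → ℕ} {d : ℕ}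
    (hc : ∀ t, t ∣ d → (∀ i, t ∣ c i) → t = 1) :
    NotProperPower d (∏ i, (X - C (b i)) ^ c i) := by
  classical
  intro t htd ht u v κ hv hκ h
  refine ht.ne' (hc t htd fun i => ?_)
  have hf : ∏ i, (X - C (b i)) ^ c i ≠ 0 :=
    prod_ne_zero_iff.2 fun i _ => pow_ne_zero _ (X_sub_C_ne_zero _)
  have hrhs : C κ * v ^ t ≠ 0 := mul_ne_zero (C_ne_zero.2 hκ) (pow_ne_zero _ hv)
  have h1 := congrArg (fun P => P.roots.count (b i)) h
  rw [roots_mul (h ▸ hrhs), roots_C_mul _ hκ, roots_pow, roots_pow, Multiset.count_add,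
    Multiset.count_nsmul, Multiset.count_nsmul, roots_prod _ _ hf] at h1
  have h2 : (univ.val.bind fun i => ((X - C (b i)) ^ c i).roots).count (b i) = c i := by
    rw [Multiset.count_bind]
    simp only [roots_pow, roots_X_sub_C, Multiset.count_nsmul, Multiset.count_singleton]
    change ∑ j, c j * (if b i = b j then 1 else 0) = c i
    simp [hb.eq_iff]
  rw [h2] at h1
  exact (Nat.dvd_add_right (dvd_mul_right t _)).1 (h1 ▸ dvd_mul_right t _)

/-- If no value of a function into `μ_d ∪ {0}` is taken too often, its sum is small. -/
lemma norm_sum_le_of_card_fiber_le {α : Type*} [Fintype α] (h : α → ℂ) {d : ℕ} (hd : 1 < d)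
    (hh : ∀ x, h x = 0 ∨ h x ^ d = 1) {n₀ : ℕ} (h0 : #{x | h x = 0} ≤ n₀) {B : ℝ}
    (hB : ∀ z : ℂ, z ≠ 0 → (d * #{x | h x = z} : ℝ) ≤ B) :
    ‖∑ x, h x‖ ≤ B - Fintype.card α + n₀ := by
  classical
  have hd0 : d ≠ 0 := by omega
  have : NeZero d := ⟨hd0⟩
  set T := nthRootsFinset d (1 : ℂ) with hT
  have hζ := Complex.isPrimitiveRoot_exp d hd0
  have hcardT : #T = d := hζ.card_nthRootsFinset
  have hmemT : ∀ z, z ∈ T ↔ z ^ d = 1 := fun z => mem_nthRootsFinset (by omega) 1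
  have hsumT : ∑ z ∈ T, z = 0 := by
    have h1 : ∏ z ∈ T, ((X : ℂ[X]) - C z) = X ^ d - 1 :=
      (X_pow_sub_one_eq_prod (by omega) hζ).symm
    have h2 := hζ.geom_sum_eq_zero hd
    rw [← h2]
    symm
    refine sum_bij (fun k _ => Complex.exp (2 * Real.pi * Complex.I / d) ^ k) ?_ ?_ ?_ ?_
    · intro k _
      rw [hmemT, pow_right_comm, hζ.pow_eq_one, one_pow]
    · intro a ha b hb hab
      exact hζ.pow_inj (mem_range.1 ha) (mem_range.1 hb) hab
    · intro z hz
      obtain ⟨i, hi, rfl⟩ := hζ.eq_pow_of_pow_eq_one ((hmemT z).1 hz)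
      exact ⟨i, mem_range.2 hi, rfl⟩
    · intros; rfl
  have hz0 : ∀ z ∈ T, z ≠ 0 := by
    rintro z hz rfl
    rw [hmemT, zero_pow hd0] at hz
    exact zero_ne_one hz
  have hnormT : ∀ z ∈ T, ‖z‖ = 1 := fun z hz =>
    Complex.norm_eq_one_of_pow_eq_one ((hmemT z).1 hz) hd0
  have hmaps : ∀ x ∈ (univ : Finset α), h x ∈ insert 0 T := fun x _ => by
    rw [mem_insert, hmemT]; exact hh x
  have h0T : (0 : ℂ) ∉ T := fun h => hz0 0 h rfl
  have hsum : ∑ x, h x = ∑ z ∈ T, (#{x | h x = z} : ℂ) * z := by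
    rw [← sum_fiberwise_of_maps_to hmaps h, sum_insert h0T]
    have : ∀ z, ∑ x with h x = z, h x = (#{x | h x = z} : ℂ) * z := fun z => by
      rw [sum_congr rfl (g := fun _ => z) fun x hx => (mem_filter.1 hx).2, sum_const, nsmul_eq_mul]
    simp only [this, mul_zero, zero_add]
  have hcard : (Fintype.card α : ℝ) = #{x | h x = 0} + ∑ z ∈ T, (#{x | h x = z} : ℝ) := by
    have := card_eq_sum_card_fiberwise hmaps
    rw [sum_insert h0T, card_univ] at this
    exact_mod_cast this
  have hdsum : (d : ℂ) * ∑ x, h x = ∑ z ∈ T, ((d : ℂ) * #{x | h x = z} - B) * z := by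
    simp only [sub_mul, sum_sub_distrib]
    rw [← mul_sum, hsumT, mul_zero, sub_zero, hsum, mul_sum]
    exact sum_congr rfl fun _ _ => by ring
  have hbound : (d : ℝ) * ‖∑ x, h x‖ ≤ ∑ z ∈ T, (B - d * #{x | h x = z}) := by
    have h3 : (d : ℝ) * ‖∑ x, h x‖ = ‖(d : ℂ) * ∑ x, h x‖ := by simp
    rw [h3, hdsum]
    refine norm_sum_le_of_le _ fun z hz => ?_
    rw [norm_mul, hnormT z hz, mul_one]
    have h4 : ((d : ℂ) * #{x | h x = z} - B) = ((d * #{x | h x = z} - B : ℝ) : ℂ) := by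
      push_cast; rfl
    rw [h4, Complex.norm_real, Real.norm_eq_abs, abs_sub_comm, abs_of_nonneg]
    linarith [hB z (hz0 z hz)]
  rw [sum_sub_distrib, sum_const, hcardT, nsmul_eq_mul, ← mul_sum, ← mul_sub] at hbound
  have hdpos : (0 : ℝ) < d := by positivity
  have h5 := le_of_mul_le_mul_left hbound hdpos
  have h6 : (#{x | h x = 0} : ℝ) ≤ n₀ := by exact_mod_cast h0
  linarith

/-- In a finite field, the kernel of a character of order `d` consists of `d`-th powers. -/
lemma pow_eq_one_of_mulChar_eq_one {F : Type*} [Field F] [Fintype F] {ψ : MulChar F ℂ}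
    {y : F} (hy : ψ y = 1) : y ^ ((Fintype.card F - 1) / orderOf ψ) = 1 := by
  classical
  obtain ⟨g, hg⟩ := IsCyclic.exists_generator (α := Fˣ)
  have hy0 : y ≠ 0 := by
    rintro rfl
    rw [MulChar.map_zero] at hy
    exact zero_ne_one hy
  obtain ⟨k, hk⟩ := (mem_powers_iff_mem_zpowers.2 (hg (Units.mk0 y hy0)))
  simp only at hk
  have hdk : orderOf ψ ∣ k := by
    rw [orderOf_dvd_iff_pow_eq_one, MulChar.eq_iff hg, MulChar.pow_apply_coe, ← map_pow,
      ← Units.val_pow_eq_pow_val, hk, Units.val_mk0, hy, MulChar.one_apply_coe]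
  obtain ⟨m, hm⟩ := hdk
  have : y = ((g ^ k : Fˣ) : F) := by rw [hk, Units.val_mk0]
  rw [this, ← Units.val_pow_eq_pow_val, hm, ← pow_mul, mul_right_comm,
    Nat.mul_div_cancel' (MulChar.orderOf_dvd_card_sub_one (χ := ψ)), pow_mul, ← Fintype.card_units,
    pow_card_eq_one, one_pow, Units.val_one]

/-- A finite family of characters consists of powers of a character of minimal order. -/
lemma exists_mulChar_generator {F ι : Type*} [Field F] [Fintype F] (χ : ι → MulChar F ℂ) :
    ∃ (ψ : MulChar F ℂ) (c : ι → ℕ), (∀ i, 0 < c i) ∧ (∀ i, χ i = ψ ^ c i) ∧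
      ∀ t, t ∣ orderOf ψ → (∀ i, t ∣ c i) → t = 1 := by
  classical
  obtain ⟨e⟩ := MulChar.mulEquiv_units F ℂ
  have : IsCyclic (MulChar F ℂ) := isCyclic_of_surjective e.symm e.symm.surjective
  obtain ⟨ψ, hψ⟩ := (Subgroup.isCyclic_iff_exists_zpowers_eq_top
    (Subgroup.closure (Set.range χ))).1 inferInstance
  have hpos : 0 < orderOf ψ := MulChar.orderOf_pos ψ
  have hmem : ∀ i, ∃ c : ℕ, 0 < c ∧ χ i = ψ ^ c := by
    intro i
    have h1 : χ i ∈ Subgroup.zpowers ψ := hψ ▸ Subgroup.subset_closure ⟨i, rfl⟩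
    obtain ⟨k, hk⟩ := (isOfFinOrder_iff_pow_eq_one.2
      ⟨_, hpos, pow_orderOf_eq_one ψ⟩).mem_powers_iff_mem_zpowers.2 h1
    refine ⟨k + orderOf ψ, by omega, ?_⟩
    rw [pow_add, pow_orderOf_eq_one, mul_one]
    exact hk.symm
  choose c hc hχ using hmem
  refine ⟨ψ, c, hc, hχ, fun t htd ht => ?_⟩
  have h2 : Subgroup.closure (Set.range χ) ≤ Subgroup.zpowers (ψ ^ t) := by
    rw [Subgroup.closure_le]
    rintro _ ⟨i, rfl⟩
    obtain ⟨m, hm⟩ := ht i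
    rw [hχ, hm, pow_mul]
    exact Subgroup.npow_mem_zpowers _ _
  have h3 : ψ ∈ Subgroup.zpowers (ψ ^ t) := h2 (hψ ▸ Subgroup.mem_zpowers ψ)
  have h4 := orderOf_dvd_of_mem_zpowers h3
  have ht0 : t ≠ 0 := by rintro rfl; rw [zero_dvd_iff] at htd; omega
  rw [orderOf_pow_of_dvd ht0 htd] at h4
  obtain ⟨m, hm⟩ := htd
  rw [hm, Nat.mul_div_cancel_left _ (Nat.pos_of_ne_zero ht0)] at h4
  have hm0 : 0 < m := Nat.pos_of_ne_zero (by rintro rfl; omega)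
  have := Nat.le_of_dvd hm0 h4
  have : 1 ≤ t := Nat.pos_of_ne_zero ht0
  nlinarith

lemma exists_isPrimitiveRoot_of_dvd_card_sub_one {K : Type*} [Field K] [Fintype K] {d : ℕ}
    (hd : d ∣ Fintype.card K - 1) : ∃ ζ : K, IsPrimitiveRoot ζ d := by
  classical
  obtain ⟨g, hg⟩ := IsCyclic.exists_ofOrder_eq_natCard (α := Kˣ)
  rw [Nat.card_eq_fintype_card, Fintype.card_units] at hg
  obtain ⟨m, hm⟩ := hd
  have hpos : 0 < Fintype.card K - 1 := Nat.sub_pos_of_lt Fintype.one_lt_card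
  have h1 : IsPrimitiveRoot (g ^ m) d :=
    (IsPrimitiveRoot.orderOf g).pow (hg ▸ hpos) (by rw [hg, hm, mul_comm])
  exact ⟨_, IsPrimitiveRoot.coe_units_iff.2 h1⟩

/-- The bound for multiplicative character sums over a large extension of square order. -/
lemma norm_charSum_extension_le {F K ι : Type*} [Field F] [Fintype F] [Field K] [Fintype K]
    [Algebra F K] [Fintype ι] (p : ℕ) [ExpChar K p] {s : ℕ}
    (hK : Fintype.card K = p ^ s * p ^ s) (hs : Fintype.card F - 1 ∣ p ^ s - 1)
    {ψ : MulChar F ℂ} {c : ι → ℕ} (hc0 : ∀ i, 0 < c i)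
    (hc : ∀ t, t ∣ orderOf ψ → (∀ i, t ∣ c i) → t = 1) (hψ : 1 < orderOf ψ)
    {b : ι → F} (hb : Function.Injective b)
    (hlarge : 4 * orderOf ψ * (∑ i, c i + 3) < p ^ s) :
    ‖∑ x : K, ∏ i, ψ (Algebra.norm F (algebraMap F K (b i) - x)) ^ c i‖ ≤
      (orderOf ψ * (9 * ∑ i, c i + 17) : ℕ) * (p : ℝ) ^ s + Fintype.card ι := by
  classical
  set d := orderOf ψ with hd
  have hdq : d ∣ Fintype.card F - 1 := MulChar.orderOf_dvd_card_sub_one (χ := ψ)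
  have hRpos : 1 < p ^ s :=
    lt_of_le_of_lt (Nat.succ_le_of_lt (Nat.mul_pos (by omega) (Nat.succ_pos _))) hlarge
  obtain ⟨E, hE⟩ := hdq.trans hs
  have hR : p ^ s = d * E + 1 := by omega
  have hcardK : Fintype.card K - 1 = d * (E * p ^ s + E) := by
    rw [hK]
    have : p ^ s * p ^ s = d * (E * p ^ s + E) + 1 := by
      have h2 : d * (E * p ^ s + E) = (d * E) * (p ^ s + 1) := by ring
      rw [h2]
      have h3 : d * E = p ^ s - 1 := hE.symm
      obtain ⟨r, hr⟩ : ∃ r, p ^ s = r + 1 := ⟨d * E, hR⟩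
      rw [h3, hr, Nat.add_sub_cancel]
      ring
    omega
  have hcardι : Fintype.card ι ≤ ∑ i, c i := by
    rw [Fintype.card_eq_sum_ones]
    exact sum_le_sum fun i _ => hc0 i
  have hιK : #(univ.image fun i => algebraMap F K (b i)) < #(univ : Finset K) := by
    refine card_image_le.trans_lt ?_
    rw [card_univ, card_univ, hK]
    nlinarith
  obtain ⟨γ, -, hγ⟩ := exists_mem_notMem_of_card_lt_card hιK
  set f : K[X] := ∏ i, (X - C (γ - algebraMap F K (b i))) ^ c i with hf
  have hinj : Function.Injective fun i => γ - algebraMap F K (b i) := fun i j hij =>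
    hb ((algebraMap F K).injective (sub_right_injective hij))
  have hnpp : NotProperPower d f := notProperPower_prod hinj hc
  have heval : ∀ x, f.eval x = ∏ i, (algebraMap F K (b i) - (γ - x)) ^ c i := fun x => by
    rw [hf, eval_prod]
    refine prod_congr rfl fun i _ => ?_
    rw [eval_pow, eval_sub, eval_X, eval_C]
    ring
  have hf0 : f.eval 0 ≠ 0 := by
    rw [heval]
    refine prod_ne_zero_iff.2 fun i _ => pow_ne_zero _ fun h => hγ ?_
    rw [sub_zero, sub_eq_zero] at h
    exact mem_image.2 ⟨i, mem_univ _, h⟩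
  have hdeg : f.natDegree = ∑ i, c i := by
    rw [hf, natDegree_prod_of_monic _ _ fun i _ => (monic_X_sub_C _).pow _]
    exact sum_congr rfl fun i _ => by rw [natDegree_pow, natDegree_X_sub_C, mul_one]
  obtain ⟨ζ, hζ⟩ := exists_isPrimitiveRoot_of_dvd_card_sub_one (K := K) ⟨_, hcardK⟩
  have hsum : ∑ x : K, ∏ i, ψ (Algebra.norm F (algebraMap F K (b i) - x)) ^ c i =
      ∑ x : K, ψ (Algebra.norm F (f.eval x)) := by
    rw [← (Equiv.subLeft γ).sum_comp]
    refine sum_congr rfl fun x _ => ?_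
    rw [heval, map_prod, map_prod]
    refine prod_congr rfl fun i _ => ?_
    rw [map_pow, map_pow, Equiv.subLeft_apply]
  have hnorm0 : ∀ y : K, ψ (Algebra.norm F y) = 0 → y = 0 := fun y hy => by
    by_contra h
    have h1 : Algebra.norm F y ≠ 0 := fun h2 => h (Algebra.norm_eq_zero_iff.1 h2)
    exact ((IsUnit.mk0 _ h1).map ψ).ne_zero hy
  have hdpow : ∀ y : F, ψ y = 0 ∨ ψ y ^ d = 1 := fun y => by
    by_cases hy : y = 0
    · left; rw [hy, MulChar.map_zero]
    · right
      rw [← MulChar.pow_apply' _ (by omega), hd, pow_orderOf_eq_one,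
        MulChar.one_apply (IsUnit.mk0 _ hy)]
  have hpow : ∀ x y : K, ψ (Algebra.norm F x) = ψ (Algebra.norm F y) →
      ψ (Algebra.norm F y) ≠ 0 → x ^ (E * p ^ s + E) = y ^ (E * p ^ s + E) := by
    intro x y hxy hy
    have hy0 : y ≠ 0 := by
      rintro rfl
      rw [Algebra.norm_zero, MulChar.map_zero] at hy
      exact hy rfl
    have h1 : ψ (Algebra.norm F (x / y)) = 1 := by
      have h2 : ψ (Algebra.norm F (x / y)) * ψ (Algebra.norm F y) = ψ (Algebra.norm F y) := by
        rw [← map_mul, ← map_mul, div_mul_cancel₀ _ hy0, hxy]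
      exact (mul_eq_right₀ hy).1 h2
    have h3 := congrArg (algebraMap F K) (pow_eq_one_of_mulChar_eq_one h1)
    rw [map_pow, FiniteField.algebraMap_norm_eq_pow, map_one, ← pow_mul,
      Nat.card_eq_fintype_card, Nat.card_eq_fintype_card, ← hd] at h3
    have h4 : (Fintype.card K - 1) / (Fintype.card F - 1) * ((Fintype.card F - 1) / d) =
        E * p ^ s + E := by
      have h5 : Fintype.card F - 1 ∣ Fintype.card K - 1 := by
        rw [hcardK, ← Nat.mul_succ, ← mul_assoc, ← hE]
        exact hs.mul_right _
      rw [Nat.div_mul_div_comm h5 hdq, mul_comm (Fintype.card F - 1) d,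
        Nat.mul_div_mul_right _ _ (Nat.sub_pos_of_lt Fintype.one_lt_card), hcardK,
        Nat.mul_div_cancel_left _ (by omega)]
    rw [h4, div_pow, div_eq_one_iff_eq (pow_ne_zero _ hy0)] at h3
    exact h3
  rw [hsum]
  have hzero : #{x : K | ψ (Algebra.norm F (f.eval x)) = 0} ≤ Fintype.card ι := by
    have : ({x : K | ψ (Algebra.norm F (f.eval x)) = 0} : Finset K) ⊆
        univ.image fun i => γ - algebraMap F K (b i) := by
      intro x hx
      have h1 := hnorm0 _ (mem_filter.1 hx).2
      rw [heval, prod_eq_zero_iff] at h1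
      obtain ⟨i, -, hi⟩ := h1
      have h2 := pow_eq_zero_iff (hc0 i).ne' |>.1 hi
      exact mem_image.2 ⟨i, mem_univ _, by linear_combination -h2⟩
    exact (card_le_card this).trans (card_image_le.trans_eq card_univ)
  have key := norm_sum_le_of_card_fiber_le (fun x : K => ψ (Algebra.norm F (f.eval x))) hψ
    (fun x => hdpow _) hzero
    (B := ((p ^ s * p ^ s + d * (9 * ∑ i, c i + 17) * p ^ s : ℕ) : ℝ)) (by
      intro z hz
      rw [← Nat.cast_mul, Nat.cast_le]
      by_cases hne : ∃ x₀, ψ (Algebra.norm F (f.eval x₀)) = z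
      · obtain ⟨x₀, rfl⟩ := hne
        have hx₀ : f.eval x₀ ≠ 0 := fun h => hz (by
          rw [h, Algebra.norm_zero, MulChar.map_zero])
        have h1 := card_filter_pow_eq_le p hζ (by omega) hR hK hf0 hnpp
          (pow_ne_zero (E * p ^ s + E) hx₀) (hdeg.symm ▸ hlarge)
        rw [hdeg] at h1
        refine le_trans (Nat.mul_le_mul_left _ (card_le_card ?_)) h1
        intro x hx
        exact mem_filter.2 ⟨mem_univ _, hpow _ _ (mem_filter.1 hx).2 hz⟩
      · have : ({x : K | ψ (Algebra.norm F (f.eval x)) = z} : Finset K) = ∅ :=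
          filter_eq_empty_iff.2 fun x _ h => hne ⟨x, h⟩
        rw [this, card_empty, mul_zero]
        exact Nat.zero_le _)
  rw [hK] at key
  refine key.trans_eq ?_
  push_cast
  ring

end Stepanov

section LFunction

open Polynomial

lemma finite_setOf_natDegree_le (F : Type*) [Field F] [Finite F] (r : ℕ) :
    {g : F[X] | g.natDegree ≤ r}.Finite := by
  have h : Function.Injective fun (g : {g : F[X] | g.natDegree ≤ r}) (i : Fin (r + 1)) =>
      g.1.coeff i := by
    rintro ⟨g, hg⟩ ⟨g', hg'⟩ h
    ext i
    by_cases hi : i < r + 1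
    · exact congrFun h ⟨i, hi⟩
    · change g.natDegree ≤ r at hg
      change g'.natDegree ≤ r at hg'
      change g.coeff i = g'.coeff i
      rw [coeff_eq_zero_of_natDegree_lt (by omega), coeff_eq_zero_of_natDegree_lt (by omega)]
  exact Finite.of_injective _ h

/-- The monic polynomials of degree `r` over a finite field. -/
noncomputable def monicsOfDegree (F : Type*) [Field F] [Finite F] (r : ℕ) : Finset F[X] :=
  ((finite_setOf_natDegree_le F r).subset
    (fun _ hg => hg.2.le : {g : F[X] | g.Monic ∧ g.natDegree = r} ⊆ _)).toFinset

/-- The monic irreducible polynomials of degree at most `r` over a finite field. -/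
noncomputable def monicIrreducibles (F : Type*) [Field F] [Finite F] (r : ℕ) : Finset F[X] :=
  ((finite_setOf_natDegree_le F r).subset
    (fun _ hg => hg.2.2 :
      {g : F[X] | g.Monic ∧ Irreducible g ∧ g.natDegree ≤ r} ⊆ _)).toFinset

section MonicFamilies

variable {F : Type*} [Field F] [Finite F]

lemma mem_monicsOfDegree {r : ℕ} {g : F[X]} :
    g ∈ monicsOfDegree F r ↔ g.Monic ∧ g.natDegree = r := by
  rw [monicsOfDegree, Set.Finite.mem_toFinset, Set.mem_ofPred_eq]

lemma mem_monicIrreducibles {r : ℕ} {g : F[X]} :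
    g ∈ monicIrreducibles F r ↔ g.Monic ∧ Irreducible g ∧ g.natDegree ≤ r := by
  rw [monicIrreducibles, Set.Finite.mem_toFinset, Set.mem_ofPred_eq]

end MonicFamilies

lemma norm_algebraMap_sub_eq_eval_minpoly {F K : Type*} [Field F] [Field K] [Algebra F K]
    [FiniteDimensional F K] (b : F) (x : K) :
    Algebra.norm F (algebraMap F K b - x) =
      ((minpoly F x).eval b) ^ (Module.finrank F K / (minpoly F x).natDegree) := by
  classical
  have hx : IsIntegral F x := Algebra.IsIntegral.isIntegral x
  set L := IntermediateField.adjoin F {x} with hL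
  set pb := IntermediateField.adjoin.powerBasis hx with hpb
  have hgen : pb.gen = IntermediateField.AdjoinSimple.gen F x := rfl
  have h1 : algebraMap F K b - x = algebraMap L K (algebraMap F L b - pb.gen) := by
    rw [map_sub, ← IsScalarTower.algebraMap_apply, hgen,
      IntermediateField.AdjoinSimple.algebraMap_gen]
  have h2 : Algebra.norm F (algebraMap F L b - pb.gen) = (minpoly F x).eval b := by
    have h3 : minpoly F x = minpoly F pb.gen := by
      rw [hgen, IntermediateField.minpoly_gen]
    rw [h3, ← charpoly_leftMulMatrix, Matrix.eval_charpoly, Algebra.norm_eq_matrix_det pb.basis,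
      map_sub, AlgHom.commutes]
    rfl
  rw [h1, ← Algebra.norm_norm (S := L), Algebra.norm_algebraMap, map_pow, h2]
  congr 1
  have h4 := Module.finrank_mul_finrank F L K
  rw [IntermediateField.adjoin.finrank hx] at h4
  rw [← h4, Nat.mul_div_cancel_left _ (minpoly.natDegree_pos hx)]

lemma card_filter_minpoly_eq {F K : Type*} [Field F] [Finite F] [Field K] [Fintype K]
    [Algebra F K] {P : F[X]} (hP : P.Monic) (hirr : Irreducible P)
    (hdvd : P.natDegree ∣ Module.finrank F K) [DecidableEq F[X]] :
    #{x : K | minpoly F x = P} = P.natDegree := by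
  classical
  have hne : (X ^ Fintype.card K - X : K[X]) ≠ 0 :=
    FiniteField.X_pow_card_sub_X_ne_zero K Fintype.one_lt_card
  have hcard : Nat.card F ^ Module.finrank F K = Fintype.card K := by
    rw [← Nat.card_eq_fintype_card, ← Module.natCard_eq_pow_finrank]
  have hdiv : P.map (algebraMap F K) ∣ X ^ Fintype.card K - X := by
    have := map_dvd (mapRingHom (algebraMap F K))
      (hirr.natDegree_dvd_iff_dvd_X_pow_card_pow_sub_X.1 hdvd)
    rw [hcard] at this
    simpa using this
  have hsplit : (X ^ Fintype.card K - X : K[X]).Splits := by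
    rw [splits_iff_card_roots, FiniteField.roots_X_pow_card_sub_X,
      FiniteField.X_pow_card_sub_X_natDegree_eq K Fintype.one_lt_card]
    exact card_univ
  have h1 := card_rootSet_eq_natDegree (PerfectField.separable_of_irreducible hirr)
    (hsplit.of_dvd hne hdiv)
  rw [← h1, Fintype.card_subtype]
  congr 1
  ext x
  rw [mem_filter_univ, mem_filter_univ, mem_rootSet_of_ne hirr.ne_zero]
  constructor
  · rintro rfl
    exact minpoly.aeval F x
  · intro hx
    exact (minpoly.eq_of_irreducible_of_monic hirr hx hP).symm

/-- Sums over an extension field as sums over irreducible polynomials. -/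
lemma sum_extension_eq_sum_irreducibles {F K : Type*} [Field F] [Finite F] [Field K]
    [Fintype K] [Algebra F K] {r : ℕ} (hr : Module.finrank F K ≤ r) (lam : F[X] → ℂ) :
    ∑ x : K, lam (minpoly F x ^ (Module.finrank F K / (minpoly F x).natDegree)) =
      ∑ P ∈ monicIrreducibles F r with P.natDegree ∣ Module.finrank F K,
        P.natDegree * lam (P ^ (Module.finrank F K / P.natDegree)) := by
  classical
  have hmaps : ∀ x ∈ (univ : Finset K), minpoly F x ∈
      ({P ∈ monicIrreducibles F r | P.natDegree ∣ Module.finrank F K} : Finset F[X]) := by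
    intro x _
    have hx : IsIntegral F x := Algebra.IsIntegral.isIntegral x
    rw [mem_filter, mem_monicIrreducibles]
    exact ⟨⟨minpoly.monic hx, minpoly.irreducible hx, (minpoly.natDegree_le x).trans hr⟩,
      minpoly.degree_dvd hx⟩
  rw [← sum_fiberwise_of_maps_to hmaps]
  refine sum_congr rfl fun P hP => ?_
  rw [mem_filter, mem_monicIrreducibles] at hP
  rw [sum_congr rfl (g := fun _ => lam (P ^ (Module.finrank F K / P.natDegree))) fun x hx => by
    rw [(mem_filter.1 hx).2], sum_const, nsmul_eq_mul,
    card_filter_minpoly_eq hP.1.1 hP.1.2.1 hP.2]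

open Classical in
/-- The degree of a polynomial is the sum of the degrees of its irreducible factors. -/
lemma sum_natDegree_pow_dvd {F : Type*} [Field F] [Finite F] {r : ℕ} {g : F[X]}
    (hg : g ∈ monicsOfDegree F r) :
    ∑ k ∈ range r, ∑ P ∈ monicIrreducibles F r with
      P.natDegree ∣ k + 1 ∧ P ^ ((k + 1) / P.natDegree) ∣ g, P.natDegree = r := by
  classical
  rw [mem_monicsOfDegree] at hg
  obtain ⟨hmon, hdeg⟩ := hg
  have hg0 := hmon.ne_zero
  set N := UniqueFactorizationMonoid.normalizedFactors g with hN
  have hmonN : ∀ P ∈ N, P.Monic := fun P hP => by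
    rw [← UniqueFactorizationMonoid.normalize_normalized_factor P hP]
    exact monic_normalize
      (UniqueFactorizationMonoid.irreducible_of_normalized_factor P hP).ne_zero
  have hsubset : N.toFinset ⊆ monicIrreducibles F r := by
    intro P hP
    rw [Multiset.mem_toFinset] at hP
    exact mem_monicIrreducibles.2 ⟨hmonN P hP,
      UniqueFactorizationMonoid.irreducible_of_normalized_factor P hP,
      hdeg ▸ natDegree_le_of_dvd (UniqueFactorizationMonoid.dvd_of_mem_normalizedFactors hP) hg0⟩
  have hcount : ∀ P ∈ monicIrreducibles F r,
      #{k ∈ range r | P.natDegree ∣ k + 1 ∧ P ^ ((k + 1) / P.natDegree) ∣ g} = N.count P := by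
    intro P hP
    obtain ⟨hPm, hPi, -⟩ := mem_monicIrreducibles.1 hP
    have hd : 0 < P.natDegree := hPi.natDegree_pos
    have hdvd : ∀ j, P ^ j ∣ g ↔ j ≤ N.count P := fun j => by
      rw [pow_dvd_iff_le_emultiplicity,
        UniqueFactorizationMonoid.emultiplicity_eq_count_normalizedFactors hPi hg0,
        hPm.normalize_eq_self, Nat.cast_le]
    rw [← card_range (N.count P)]
    symm
    refine card_bij (fun j _ => P.natDegree * (j + 1) - 1) ?_ ?_ ?_
    · intro j hj
      have h1 : P.natDegree * (j + 1) - 1 + 1 = P.natDegree * (j + 1) :=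
        Nat.sub_add_cancel (Nat.mul_pos hd (Nat.succ_pos _))
      have h2 : P ^ (j + 1) ∣ g := (hdvd _).2 (mem_range.1 hj)
      rw [mem_filter, mem_range, h1, Nat.mul_div_cancel_left _ hd]
      refine ⟨?_, dvd_mul_right _ _, h2⟩
      have h3 := natDegree_le_of_dvd h2 hg0
      rw [natDegree_pow, hdeg, mul_comm] at h3
      omega
    · intro i _ j _ hij
      have h1 := Nat.mul_pos hd (Nat.succ_pos i)
      have h2 := Nat.mul_pos hd (Nat.succ_pos j)
      have h3 : P.natDegree * (i + 1) = P.natDegree * (j + 1) := by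
        simp only [Nat.succ_eq_add_one] at h1 h2
        omega
      simpa using Nat.eq_of_mul_eq_mul_left hd h3
    · intro k hk
      obtain ⟨-, ⟨m, hm⟩, h2⟩ := mem_filter.1 hk
      rw [hm, Nat.mul_div_cancel_left _ hd, hdvd] at h2
      have hm0 : m ≠ 0 := by rintro rfl; omega
      refine ⟨m - 1, mem_range.2 (by omega), ?_⟩
      rw [Nat.sub_add_cancel (by omega), ← hm, Nat.add_sub_cancel]
  simp_rw [sum_filter]
  rw [sum_comm]
  simp_rw [← sum_filter, sum_const]
  rw [sum_congr rfl fun P hP => by rw [hcount P hP]]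
  have hsum : ∑ P ∈ N.toFinset, N.count P • P.natDegree = r := by
    rw [← sum_multiset_map_count, ← natDegree_multiset_prod_of_monic _ hmonN,
      UniqueFactorizationMonoid.prod_normalizedFactors_eq hg0, hmon.normalize_eq_self, hdeg]
  refine Eq.trans (Eq.symm ?_) hsum
  refine sum_subset hsubset fun P _ hP => ?_
  rw [Multiset.mem_toFinset, ← Multiset.count_eq_zero] at hP
  rw [hP, zero_smul]

lemma mul_sum_monicsOfDegree {F : Type*} [Field F] [Finite F] {lam : F[X] →* ℂ} {Q : F[X]}
    (hQ : Q.Monic) {r k : ℕ} (hk : Q.natDegree = k) (hr : k ≤ r) [DecidableEq F[X]]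
    [DecidablePred fun g => Q ∣ g] :
    lam Q * ∑ h ∈ monicsOfDegree F (r - k), lam h = ∑ g ∈ monicsOfDegree F r with Q ∣ g, lam g := by
  rw [mul_sum]
  refine sum_bij (fun h _ => Q * h) ?_ ?_ ?_ ?_
  · intro h hh
    obtain ⟨h1, h2⟩ := mem_monicsOfDegree.1 hh
    rw [mem_filter, mem_monicsOfDegree, hQ.natDegree_mul h1, h2]
    exact ⟨⟨hQ.mul h1, by omega⟩, dvd_mul_right _ _⟩
  · intro a _ b _ hab
    exact mul_left_cancel₀ hQ.ne_zero hab
  · intro g hg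
    obtain ⟨h1, h, rfl⟩ := mem_filter.1 hg
    obtain ⟨h2, h3⟩ := mem_monicsOfDegree.1 h1
    have h4 := hQ.of_mul_monic_left h2
    rw [hQ.natDegree_mul h4] at h3
    exact ⟨h, mem_monicsOfDegree.2 ⟨h4, by omega⟩, rfl⟩
  · intro h _
    rw [map_mul]

/-- The logarithmic derivative of the `L`-function of a multiplicative function. -/
lemma natCast_mul_sum_monicsOfDegree {F : Type*} [Field F] [Finite F] (lam : F[X] →* ℂ)
    (r : ℕ) :
    r * ∑ g ∈ monicsOfDegree F r, lam g =
      ∑ k ∈ range r, (∑ P ∈ monicIrreducibles F r with P.natDegree ∣ k + 1,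
        P.natDegree * lam (P ^ ((k + 1) / P.natDegree))) *
          ∑ h ∈ monicsOfDegree F (r - (k + 1)), lam h := by
  classical
  have h1 : r * ∑ g ∈ monicsOfDegree F r, lam g = ∑ g ∈ monicsOfDegree F r,
      ∑ k ∈ range r, ∑ P ∈ monicIrreducibles F r, if P.natDegree ∣ k + 1 then
        (if P ^ ((k + 1) / P.natDegree) ∣ g then P.natDegree * lam g else 0) else 0 := by
    rw [mul_sum]
    refine sum_congr rfl fun g hg => ?_
    have h2 := congrArg (fun n : ℕ => (n : ℂ) * lam g) (sum_natDegree_pow_dvd hg)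
    simp only [← h2, Nat.cast_sum, sum_mul, sum_filter]
    refine sum_congr rfl fun k _ => sum_congr rfl fun P _ => ?_
    rw [← ite_and]
    split_ifs <;> simp
  rw [h1, sum_comm]
  refine sum_congr rfl fun k hk => ?_
  rw [sum_comm, sum_mul, sum_filter]
  refine sum_congr rfl fun P hP => ?_
  split_ifs with hd
  · obtain ⟨hPm, hPi, -⟩ := mem_monicIrreducibles.1 hP
    have hdeg : (P ^ ((k + 1) / P.natDegree)).natDegree = k + 1 := by
      rw [natDegree_pow, Nat.div_mul_cancel hd]
    rw [mul_assoc, mul_sum_monicsOfDegree (hPm.pow _) hdeg (mem_range.1 hk), mul_sum, sum_filter]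
  · rw [sum_const_zero]

/-- The `L`-function of a product of characters is a polynomial. -/
lemma sum_monicsOfDegree_eq_zero {F ι : Type*} [Field F] [Finite F] [Fintype ι]
    (χ : ι → MulChar F ℂ) {j : ι} (hj : χ j ≠ 1) {b : ι → F} (hb : Function.Injective b) {r : ℕ}
    (hr : Fintype.card ι ≤ r) :
    ∑ g ∈ monicsOfDegree F r, ∏ i, χ i (g.eval (b i)) = 0 := by
  classical
  obtain ⟨a, ha⟩ := MulChar.ne_one_iff.1 hj
  set ℓ := Lagrange.basis univ b j with hℓ
  have hℓj : ℓ.eval (b j) = 1 := Lagrange.eval_basis_self hb.injOn (mem_univ j)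
  have hℓi : ∀ i, i ≠ j → ℓ.eval (b i) = 0 := fun i hi =>
    Lagrange.eval_basis_of_ne hi.symm (mem_univ i)
  have hℓdeg : ℓ.degree < r := by
    rw [Lagrange.degree_basis hb.injOn (mem_univ j), card_univ]
    have : 0 < Fintype.card ι := Fintype.card_pos_iff.2 ⟨j⟩
    exact_mod_cast (by omega : Fintype.card ι - 1 < r)
  set T : F → F[X] → F[X] := fun c g => g + C ((c - 1) * g.eval (b j)) * ℓ with hT
  have hTj : ∀ c g, (T c g).eval (b j) = c * g.eval (b j) := fun c g => by
    simp only [hT, eval_add, eval_mul, eval_C, hℓj]; ring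
  have hTi : ∀ c g i, i ≠ j → (T c g).eval (b i) = g.eval (b i) := fun c g i hi => by
    simp only [hT, eval_add, eval_mul, eval_C, hℓi i hi]; ring
  have hTT : ∀ c c' g, c * c' = 1 → T c (T c' g) = g := fun c c' g hcc => by
    have h1 : T c (T c' g) = T c' g + C ((c - 1) * (c' * g.eval (b j))) * ℓ := by
      rw [← hTj]
    have h2 : (c - 1) * (c' * g.eval (b j)) = - ((c' - 1) * g.eval (b j)) := by
      linear_combination g.eval (b j) * hcc
    rw [h1, h2, C_neg]
    simp only [hT]
    ring
  have hmem : ∀ c, ∀ g ∈ monicsOfDegree F r, T c g ∈ monicsOfDegree F r := by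
    intro c g hg
    rw [mem_monicsOfDegree] at hg ⊢
    have h1 : (C ((c - 1) * g.eval (b j)) * ℓ).degree < g.degree := by
      rw [degree_eq_natDegree hg.1.ne_zero, hg.2]
      rw [← smul_eq_C_mul]
      exact (degree_smul_le _ _).trans_lt hℓdeg
    exact ⟨hg.1.add_of_left h1, by rw [natDegree_add_eq_left_of_degree_lt h1, hg.2]⟩
  have hsum : ∑ g ∈ monicsOfDegree F r, ∏ i, χ i (g.eval (b i)) =
      χ j a * ∑ g ∈ monicsOfDegree F r, ∏ i, χ i (g.eval (b i)) := by
    rw [mul_sum]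
    symm
    refine sum_bij' (fun g _ => T a g) (fun g _ => T ((a⁻¹ : Fˣ) : F) g) (fun g hg => hmem _ g hg)
      (fun g hg => hmem _ g hg) (fun g _ => hTT _ _ _ (by simp)) (fun g _ => hTT _ _ _ (by simp))
      fun g _ => ?_
    rw [← mul_prod_erase univ _ (mem_univ j), ← mul_prod_erase univ _ (mem_univ j), hTj, map_mul,
      mul_assoc]
    congr 2
    exact prod_congr rfl fun i hi => by rw [hTi _ _ _ (ne_of_mem_erase hi)]
  by_contra hne
  exact ha ((mul_eq_right₀ hne).1 hsum.symm)

open Filter Topology in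
/-- Exponential bounds on power sums bound the individual terms. -/
lemma norm_le_of_norm_sum_pow_le {ι : Type*} [Fintype ι] (ω : ι → ℂ) {ρ C : ℝ} (hρ : 0 ≤ ρ)
    (h : ∀ᶠ k : ℕ in atTop, ‖∑ i, ω i ^ k‖ ≤ C * ρ ^ k) (i : ι) : ‖ω i‖ ≤ ρ := by
  classical
  obtain ⟨j, -, hj⟩ := exists_max_image univ (fun i => ‖ω i‖) ⟨i, mem_univ i⟩
  refine (hj i (mem_univ i)).trans ?_
  by_contra! hlt
  set ν := ‖ω j‖ with hν
  have hν0 : 0 < ν := hρ.trans_lt hlt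
  set u : ι → ℂ := fun i => ω i / ν with hu
  have hu1 : ∀ i, ‖u i‖ ≤ 1 := fun i => by
    rw [hu, norm_div, Complex.norm_real, Real.norm_of_nonneg hν0.le]
    exact (div_le_one hν0).2 (hj i (mem_univ i))
  have huj : ‖u j‖ = 1 := by
    rw [hu, norm_div, Complex.norm_real, Real.norm_of_nonneg hν0.le]
    exact div_self hν0.ne'
  have hlim : Tendsto (fun k : ℕ => ∑ i, u i ^ k) atTop (𝓝 0) := by
    have h1 : Tendsto (fun k : ℕ => C * (ρ / ν) ^ k) atTop (𝓝 0) := by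
      simpa using (tendsto_pow_atTop_nhds_zero_of_lt_one (div_nonneg hρ hν0.le)
        ((div_lt_one hν0).2 hlt)).const_mul C
    refine squeeze_zero_norm' ?_ h1
    filter_upwards [h] with k hk
    have h2 : ∑ i, u i ^ k = (∑ i, ω i ^ k) / (ν : ℂ) ^ k := by
      rw [sum_div]
      exact sum_congr rfl fun i _ => div_pow _ _ _
    rw [h2, norm_div, norm_pow, Complex.norm_real, Real.norm_of_nonneg hν0.le, div_pow,
      ← mul_div_assoc]
    exact div_le_div_of_nonneg_right hk (by positivity)
  set I : Finset ι := {i | ‖u i‖ = 1} with hI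
  have hlimI : Tendsto (fun k : ℕ => ∑ i ∈ I, u i ^ k) atTop (𝓝 0) := by
    have h1 : Tendsto (fun k : ℕ => ∑ i ∈ univ with ¬ ‖u i‖ = 1, u i ^ k) atTop (𝓝 0) := by
      rw [← sum_const_zero]
      refine tendsto_finsetSum _ fun i hi => ?_
      exact tendsto_pow_atTop_nhds_zero_of_norm_lt_one
        (lt_of_le_of_ne (hu1 i) (mem_filter.1 hi).2)
    have h2 := hlim.sub h1
    rw [sub_zero] at h2
    refine h2.congr fun k => ?_
    rw [← sum_filter_add_sum_filter_not univ (fun i => ‖u i‖ = 1), add_sub_cancel_right]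
  have hcompact : IsCompact (Metric.closedBall (0 : ι → ℂ) 1) := isCompact_closedBall _ _
  obtain ⟨a, -, φ, hφ, hconv⟩ := hcompact.tendsto_subseq
    (x := fun k => fun i => u i ^ k) fun k => by
      rw [mem_closedBall_zero_iff, pi_norm_le_iff_of_nonneg zero_le_one]
      intro i
      rw [norm_pow]
      exact pow_le_one₀ (norm_nonneg _) (hu1 i)
  obtain ⟨N, hN⟩ := Metric.cauchySeq_iff.1 hconv.cauchySeq (1 / 2) (by norm_num)
  have hmono : Tendsto (fun T => φ (N + T) - φ N) atTop atTop := by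
    refine tendsto_atTop_mono (fun T => ?_) tendsto_id
    have := hφ.add_le_nat T N
    rw [add_comm N T, id]
    omega
  have hlow : ∀ T, 1 / 2 ≤ ‖∑ i ∈ I, u i ^ (φ (N + T) - φ N)‖ := by
    intro T
    have h3 : ∀ i ∈ I, ‖u i ^ (φ (N + T) - φ N) - 1‖ ≤ 1 / 2 := by
      intro i hi
      have hi1 : ‖u i‖ = 1 := (mem_filter.1 hi).2
      have h4 := (dist_le_pi_dist _ _ i).trans (hN (N + T) (by omega) N le_rfl).le
      have h5 : u i ^ φ (N + T) = u i ^ (φ (N + T) - φ N) * u i ^ φ N := by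
        rw [← pow_add, Nat.sub_add_cancel (hφ.monotone (Nat.le_add_right N T))]
      simp only [Function.comp_apply, dist_eq_norm] at h4
      rwa [h5, ← sub_one_mul, norm_mul, norm_pow, hi1, one_pow, mul_one] at h4
    have h6 : ‖∑ i ∈ I, (u i ^ (φ (N + T) - φ N) - 1)‖ ≤ #I * (1 / 2) := by
      refine (norm_sum_le_of_le _ h3).trans_eq ?_
      rw [sum_const, nsmul_eq_mul]
    rw [sum_sub_distrib, sum_const, nsmul_eq_mul, mul_one, norm_sub_rev] at h6
    have h7 := norm_sub_norm_le (#I : ℂ) (∑ i ∈ I, u i ^ (φ (N + T) - φ N))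
    rw [Complex.norm_natCast] at h7
    have h8 : (1 : ℝ) ≤ #I := by
      exact_mod_cast card_pos.2 ⟨j, mem_filter.2 ⟨mem_univ _, huj⟩⟩
    linarith
  have h9 := ge_of_tendsto' (hlimI.comp hmono).norm hlow
  rw [norm_zero] at h9
  norm_num at h9

/-- Newton's identities, in terms of the coefficients of `∏ i, (1 - ω i * T)`. -/
lemma newton_identity_neg {m : ℕ} (ω : Fin m → ℂ) (r : ℕ) :
    r * ((-1) ^ r * (univ.val.map ω).esymm r) = ∑ k ∈ range r, (- ∑ i, ω i ^ (k + 1)) *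
      ((-1) ^ (r - (k + 1)) * (univ.val.map ω).esymm (r - (k + 1))) := by
  have h := congrArg (MvPolynomial.aeval ω) (MvPolynomial.mul_esymm_eq_sum (Fin m) ℂ r)
  simp only [map_mul, map_natCast, map_pow, map_neg, map_one, map_sum,
    MvPolynomial.aeval_esymm_eq_multiset_esymm, MvPolynomial.psum, MvPolynomial.aeval_X] at h
  have h1 : ∑ a ∈ antidiagonal r with a.1 < r, (-1 : ℂ) ^ a.1 * (univ.val.map ω).esymm a.1 *
      ∑ i, ω i ^ a.2 = ∑ k ∈ range r, (-1 : ℂ) ^ (r - (k + 1)) *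
        (univ.val.map ω).esymm (r - (k + 1)) * ∑ i, ω i ^ (k + 1) := by
    symm
    refine sum_bij (fun k _ => (r - (k + 1), k + 1)) ?_ ?_ ?_ ?_
    · intro k hk
      have := mem_range.1 hk
      simp only [mem_filter, HasAntidiagonal.mem_antidiagonal]
      omega
    · intro a _ b _ hab
      simpa using congrArg Prod.snd hab
    · rintro ⟨a, b⟩ hab
      simp only [mem_filter, HasAntidiagonal.mem_antidiagonal] at hab
      refine ⟨b - 1, mem_range.2 (by omega), ?_⟩
      ext <;> simp <;> omega
    · intros; rfl
  rw [mul_left_comm, h, h1, ← mul_assoc, ← pow_add, mul_sum]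
  refine sum_congr rfl fun k _ => ?_
  rw [show r + (r + 1) = 2 * r + 1 by ring, pow_succ, pow_mul, neg_one_sq, one_pow]
  ring

/-- If `A` and `S` are related like elementary symmetric functions and power sums, with finitely
many nonzero `A r`, then `S` is given by power sums. -/
lemma exists_eq_neg_sum_pow {A S : ℕ → ℂ} {m : ℕ} (h0 : A 0 = 1) (hA : ∀ r, m < r → A r = 0)
    (h : ∀ r : ℕ, r * A r = ∑ k ∈ range r, S (k + 1) * A (r - (k + 1))) :
    ∃ ω : Fin m → ℂ, ∀ k, S (k + 1) = - ∑ i, ω i ^ (k + 1) := by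
  classical
  set Q : ℂ[X] := ∑ r ∈ range (m + 1), C (A r) * X ^ (m - r) with hQ
  have hcoeff : ∀ r, r ≤ m → Q.coeff (m - r) = A r := by
    intro r hr
    simp only [hQ, finsetSum_coeff, coeff_C_mul_X_pow]
    rw [sum_eq_single r]
    · rw [if_pos rfl]
    · intro b hb hbr
      have := mem_range.1 hb
      rw [if_neg (by omega)]
    · intro hr'
      exact absurd (mem_range.2 (by omega)) hr'
  have hle : Q.natDegree ≤ m := natDegree_sum_le_of_forall_le _ _ fun r _ =>
    (natDegree_C_mul_X_pow_le _ _).trans (Nat.sub_le _ _)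
  have hm1 : Q.coeff m = 1 := by rw [← h0, ← hcoeff 0 (Nat.zero_le _), Nat.sub_zero]
  have hmonic : Q.Monic := monic_of_natDegree_le_of_coeff_eq_one m hle hm1
  have hnat : Q.natDegree = m :=
    le_antisymm hle (le_natDegree_of_ne_zero (hm1.symm ▸ one_ne_zero))
  have hcard : Q.roots.card = Q.natDegree :=
    (IsAlgClosed.splits Q).natDegree_eq_card_roots.symm
  obtain ⟨ω, hω⟩ : ∃ ω : Fin m → ℂ, univ.val.map ω = Q.roots := by
    have hlen : Q.roots.toList.length = m := by rw [Multiset.length_toList, hcard, hnat]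
    refine ⟨fun i => Q.roots.toList.get (i.cast hlen.symm), ?_⟩
    rw [Fin.univ_val_map]
    refine Eq.trans (congrArg _ ?_) (Multiset.coe_toList Q.roots)
    refine List.ext_get (by simp [hlen]) fun i h1 h2 => ?_
    simp
  have hAe : ∀ r, A r = (-1) ^ r * (univ.val.map ω).esymm r := by
    intro r
    by_cases hr : r ≤ m
    · rw [← hcoeff r hr, coeff_eq_esymm_roots_of_card hcard (by omega), hmonic.leadingCoeff,
        one_mul, hnat, Nat.sub_sub_self hr, hω]
    · rw [hA r (by omega), hω, Multiset.esymm, Multiset.powersetCard_eq_empty _ (by omega)]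
      simp
  refine ⟨ω, fun k => ?_⟩
  induction k using Nat.strong_induction_on with
  | _ k ih =>
    have h2 := h (k + 1)
    rw [hAe (k + 1), newton_identity_neg, sum_range_succ, sum_range_succ, Nat.sub_self, h0] at h2
    rw [sum_congr rfl (g := fun x => S (x + 1) * A (k + 1 - (x + 1))) fun x hx => by
      rw [ih x (mem_range.1 hx), hAe (k + 1 - (x + 1))]] at h2
    have h3 := add_left_cancel h2
    rw [← hAe 0, h0, mul_one, mul_one] at h3
    exact h3.symm

/-- The completely multiplicative function on polynomials attached to a family of characters. -/
noncomputable def evalCharHom {F ι : Type*} [Field F] [Fintype ι] (χ : ι → MulChar F ℂ)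
    (b : ι → F) : F[X] →* ℂ where
  toFun g := ∏ i, χ i (g.eval (b i))
  map_one' := by simp
  map_mul' g h := by simp [prod_mul_distrib]

lemma sum_norm_eq_sum_irreducibles {F K ι : Type*} [Field F] [Finite F] [Field K]
    [Fintype K] [Algebra F K] [Fintype ι] (χ : ι → MulChar F ℂ) (b : ι → F) {k r : ℕ}
    (hk : Module.finrank F K = k) (hr : k ≤ r) :
    ∑ x : K, ∏ i, χ i (Algebra.norm F (algebraMap F K (b i) - x)) =
      ∑ P ∈ monicIrreducibles F r with P.natDegree ∣ k,
        P.natDegree * evalCharHom χ b (P ^ (k / P.natDegree)) := by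
  subst hk
  rw [← sum_extension_eq_sum_irreducibles hr]
  refine sum_congr rfl fun x _ => prod_congr rfl fun i _ => ?_
  rw [norm_algebraMap_sub_eq_eval_minpoly, eval_pow]

/-- **Weil's bound** for products of multiplicative characters evaluated at linear polynomials. -/
theorem norm_sum_prod_mulChar_sub_le {F ι : Type*} [Field F] [Fintype F] [Fintype ι]
    (χ : ι → MulChar F ℂ) {j : ι} (hj : χ j ≠ 1) {b : ι → F} (hb : Function.Injective b) :
    ‖∑ x : F, ∏ i, χ i (b i - x)‖ ≤
      ((Fintype.card ι : ℝ) - 1) * Real.sqrt (Fintype.card F) := by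
  classical
  obtain ⟨p, hp⟩ := CharP.exists F
  have hpf : Fact p.Prime := ⟨CharP.char_is_prime F p⟩
  obtain ⟨ψ, c, hc0, hχ, hc⟩ := exists_mulChar_generator χ
  obtain ⟨a, -, ha⟩ := FiniteField.card F p
  set q := Fintype.card F with hq
  set n := Fintype.card ι with hn
  have hn0 : 0 < n := Fintype.card_pos_iff.2 ⟨j⟩
  let S : ℕ → ℂ := fun k =>
    letI := Fintype.ofFinite (FiniteField.Extension F p (k - 1 + 1))
    ∑ x : FiniteField.Extension F p (k - 1 + 1),
      ∏ i, χ i (Algebra.norm F (algebraMap F _ (b i) - x))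
  have hSirr : ∀ k r, k + 1 ≤ r → S (k + 1) = ∑ P ∈ monicIrreducibles F r with
      P.natDegree ∣ k + 1, P.natDegree * evalCharHom χ b (P ^ ((k + 1) / P.natDegree)) := by
    intro k r hr
    let _ : Fintype (FiniteField.Extension F p (k + 1 - 1 + 1)) := Fintype.ofFinite _
    exact sum_norm_eq_sum_irreducibles χ b (FiniteField.finrank_extension F p (k + 1)) hr
  have hA0 : ∑ g ∈ monicsOfDegree F 0, evalCharHom χ b g = 1 := by
    have : monicsOfDegree F 0 = {1} := by
      ext g
      rw [mem_monicsOfDegree, mem_singleton]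
      exact ⟨fun h => eq_one_of_monic_natDegree_zero h.1 h.2, by rintro rfl; simp⟩
    rw [this, sum_singleton, map_one]
  obtain ⟨ω, hω⟩ := exists_eq_neg_sum_pow
    (A := fun r => ∑ g ∈ monicsOfDegree F r, evalCharHom χ b g) (S := S) (m := n - 1) hA0
    (fun r hr => sum_monicsOfDegree_eq_zero χ hj hb (by omega)) (fun r => by
      rw [natCast_mul_sum_monicsOfDegree]
      refine sum_congr rfl fun k hk => ?_
      rw [hSirr k r (mem_range.1 hk)])
  have hψ : 1 < orderOf ψ := by
    have h1 : 0 < orderOf ψ := ψ.orderOf_pos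
    have h2 : orderOf ψ ≠ 1 := fun h => hj (by
      rw [hχ, orderOf_eq_one_iff.1 h, one_pow])
    omega
  have hbound : ∀ᶠ m : ℕ in Filter.atTop, ‖∑ i, (ω i ^ 2) ^ m‖ ≤
      ((orderOf ψ * (9 * ∑ i, c i + 17) : ℕ) + n : ℝ) * (q : ℝ) ^ m := by
    filter_upwards [Filter.eventually_ge_atTop (4 * orderOf ψ * (∑ i, c i + 3)),
      Filter.eventually_ge_atTop 1] with m hm hm1
    obtain ⟨k, hk⟩ : ∃ k, 2 * m = k + 1 := ⟨2 * m - 1, by omega⟩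
    let _ : Fintype (FiniteField.Extension F p (k + 1)) := Fintype.ofFinite _
    have hqm : q ^ m = p ^ (a * m) := by rw [ha, pow_mul]
    have hK : Fintype.card (FiniteField.Extension F p (k + 1)) =
        p ^ (a * m) * p ^ (a * m) := by
      rw [← Nat.card_eq_fintype_card, FiniteField.natCard_extension, ← hk, ← hqm,
        Nat.card_eq_fintype_card, ← hq, two_mul, pow_add]
    have : CharP (FiniteField.Extension F p (k + 1)) p :=
      charP_of_injective_algebraMap
        (algebraMap F (FiniteField.Extension F p (k + 1))).injective p
    have : ExpChar (FiniteField.Extension F p (k + 1)) p := ExpChar.prime hpf.out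
    have hlarge : 4 * orderOf ψ * (∑ i, c i + 3) < p ^ (a * m : ℕ) := by
      refine hm.trans_lt (Nat.lt_two_pow_self.trans_le ?_)
      exact (Nat.pow_le_pow_left hpf.out.two_le m).trans
        (Nat.pow_le_pow_right hpf.out.pos (Nat.le_mul_of_pos_left m a.pos))
    have h1 := norm_charSum_extension_le (F := F) p hK (by
      rw [← hqm, ← hq]
      simpa using Nat.sub_dvd_pow_sub_pow q 1 m) hc0 hc hψ hb hlarge
    have h2 : S (k + 1) = ∑ x : FiniteField.Extension F p (k + 1),
        ∏ i, ψ (Algebra.norm F (algebraMap F _ (b i) - x)) ^ c i := by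
      refine sum_congr rfl fun x _ => prod_congr rfl fun i _ => ?_
      rw [hχ i, MulChar.pow_apply' _ (hc0 i).ne']
      rfl
    simp_rw [← pow_mul, hk]
    rw [← norm_neg, ← hω, h2]
    refine h1.trans ?_
    have h3 : (q : ℝ) ^ m = (p : ℝ) ^ (a * m : ℕ) := by exact_mod_cast hqm
    have h4 : (1 : ℝ) ≤ (q : ℝ) ^ m := one_le_pow₀ (by
      exact_mod_cast Fintype.card_pos)
    rw [← h3, add_mul]
    have h5 : (n : ℝ) * 1 ≤ n * (q : ℝ) ^ m := by gcongr
    linarith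
  have hle : ∀ i, ‖ω i‖ ≤ Real.sqrt q := fun i => by
    have := norm_le_of_norm_sum_pow_le (fun i => ω i ^ 2) (Nat.cast_nonneg q) hbound i
    rw [norm_pow] at this
    exact Real.le_sqrt_of_sq_le this
  have hS1 : S 1 = ∑ x : F, ∏ i, χ i (b i - x) := by
    rw [hSirr 0 1 le_rfl, ← sum_norm_eq_sum_irreducibles χ b (Module.finrank_self F) le_rfl]
    simp [Algebra.norm_self]
  rw [← hS1, hω 0, norm_neg]
  have h : ∀ i ∈ univ, ‖ω i ^ (0 + 1)‖ ≤ Real.sqrt q := fun i _ => by simpa using hle i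
  refine (norm_sum_le_of_le _ h).trans_eq ?_
  rw [sum_const, card_univ, Fintype.card_fin, nsmul_eq_mul, Nat.cast_sub hn0, Nat.cast_one]

lemma norm_sum_prod_mulChar_add_le {F ι : Type*} [Field F] [Fintype F] [Fintype ι]
    (χ : ι → MulChar F ℂ) {j : ι} (hj : χ j ≠ 1) {b : ι → F} (hb : Function.Injective b) :
    ‖∑ x : F, ∏ i, χ i (x + b i)‖ ≤
      ((Fintype.card ι : ℝ) - 1) * Real.sqrt (Fintype.card F) := by
  rw [← Equiv.sum_comp (Equiv.neg F)]
  simp_rw [Equiv.neg_apply, neg_add_eq_sub]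
  exact norm_sum_prod_mulChar_sub_le χ hj hb

end LFunction

section CharacterCombinations

/-- `φ` is a linear combination of characters in `S` whose coefficients have `ℓ¹` norm at most
`B`. -/
def IsCharCombination {F : Type*} [Field F] (S : Set (MulChar F ℂ)) (B : ℝ) (φ : F → ℂ) : Prop :=
  ∃ (T : Type) (_ : Fintype T) (a : T → ℂ) (χ : T → MulChar F ℂ),
    (∀ t, χ t ∈ S) ∧ ∑ t, ‖a t‖ ≤ B ∧ ∀ x, φ x = ∑ t, a t * χ t x

lemma IsCharCombination.mul {F : Type*} [Field F] {S₁ S₂ S : Set (MulChar F ℂ)} {B₁ B₂ : ℝ}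
    {φ₁ φ₂ : F → ℂ} (h₁ : IsCharCombination S₁ B₁ φ₁) (h₂ : IsCharCombination S₂ B₂ φ₂)
    (hS : ∀ χ₁ ∈ S₁, ∀ χ₂ ∈ S₂, χ₁ * χ₂ ∈ S) :
    IsCharCombination S (B₁ * B₂) (fun x => φ₁ x * φ₂ x) := by
  obtain ⟨T₁, _, a₁, χ₁, hm₁, hB₁, hφ₁⟩ := h₁
  obtain ⟨T₂, _, a₂, χ₂, hm₂, hB₂, hφ₂⟩ := h₂
  refine ⟨T₁ × T₂, inferInstance, fun t => a₁ t.1 * a₂ t.2, fun t => χ₁ t.1 * χ₂ t.2,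
    fun t => hS _ (hm₁ _) _ (hm₂ _), ?_, fun x => ?_⟩
  · simp_rw [norm_mul]
    rw [Fintype.sum_prod_type]
    dsimp only
    rw [← sum_mul_sum]
    exact mul_le_mul hB₁ hB₂ (sum_nonneg fun _ _ => norm_nonneg _)
      ((sum_nonneg fun _ _ => norm_nonneg _).trans hB₁)
  · dsimp only
    rw [hφ₁, hφ₂, sum_mul_sum, Fintype.sum_prod_type]
    simp_rw [MulChar.mul_apply, mul_mul_mul_comm]

lemma norm_sum_prod_isCharCombination_le {F ι : Type*} [Field F] [Fintype F] [Fintype ι]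
    {S : ι → Set (MulChar F ℂ)} {B : ι → ℝ} {φ : ι → F → ℂ}
    (h : ∀ i, IsCharCombination (S i) (B i) (φ i)) {j : ι} (hj : (1 : MulChar F ℂ) ∉ S j)
    {b : ι → F} (hb : Function.Injective b) :
    ‖∑ x : F, ∏ i, φ i (x + b i)‖ ≤
      (∏ i, B i) * (((Fintype.card ι : ℝ) - 1) * Real.sqrt (Fintype.card F)) := by
  classical
  choose T _ a χ hm hB hφ using h
  have hcard : (0 : ℝ) ≤ (Fintype.card ι : ℝ) - 1 :=
    sub_nonneg.2 (by exact_mod_cast Fintype.card_pos_iff.2 ⟨j⟩)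
  have h1 : ∑ x : F, ∏ i, φ i (x + b i) =
      ∑ t : (∀ i, T i), (∏ i, a i (t i)) * ∑ x : F, ∏ i, χ i (t i) (x + b i) := by
    simp_rw [hφ, prod_univ_sum, Fintype.piFinset_univ, mul_sum]
    rw [sum_comm]
    simp_rw [prod_mul_distrib]
  rw [h1]
  calc _ ≤ ∑ t : (∀ i, T i), (∏ i, ‖a i (t i)‖) *
        (((Fintype.card ι : ℝ) - 1) * Real.sqrt (Fintype.card F)) := by
        refine norm_sum_le_of_le _ fun t _ => ?_
        rw [norm_mul, norm_prod]
        gcongr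
        exact norm_sum_prod_mulChar_add_le (fun i => χ i (t i))
          (fun h => hj (h ▸ hm j (t j))) hb
    _ = (∏ i, ∑ t, ‖a i t‖) * (((Fintype.card ι : ℝ) - 1) * Real.sqrt (Fintype.card F)) := by
        rw [← sum_mul, prod_univ_sum, Fintype.piFinset_univ]
    _ ≤ _ := by
        gcongr with i
        exact hB i

open Classical in
lemma sum_mulChar_pow_eq {F : Type*} [Field F] [Fintype F] {l : ℕ} (hl : l.Prime)
    (hlF : l ∣ Fintype.card F - 1) : ∃ ψ : MulChar F ℂ, orderOf ψ = l ∧ ∀ x : F, x ≠ 0 →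
      ∑ k ∈ range l, (ψ ^ k) x = if ∃ h, x = h ^ l then (l : ℂ) else 0 := by
  obtain ⟨ψ, hψ⟩ := MulChar.exists_mulChar_orderOf F hlF
    (Complex.isPrimitiveRoot_exp l hl.ne_zero)
  refine ⟨ψ, hψ, fun x hx => ?_⟩
  have happ : ∀ k, (ψ ^ k) x = ψ x ^ k := fun k => by
    rw [← Units.val_mk0 hx, MulChar.pow_apply_coe]
  simp_rw [happ]
  have hpow : ψ x ^ l = 1 := by
    rw [← happ, ← hψ, pow_orderOf_eq_one, ← Units.val_mk0 hx, MulChar.one_apply_coe]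
  split_ifs with h
  · obtain ⟨h, rfl⟩ := h
    have hh : h ≠ 0 := by rintro rfl; exact hx (zero_pow hl.ne_zero)
    have : ψ (h ^ l) = 1 := by
      rw [map_pow, ← Units.val_mk0 hh, ← MulChar.pow_apply_coe, ← hψ, pow_orderOf_eq_one,
        MulChar.one_apply_coe]
    simp [this]
  · have h1 : ψ x ≠ 1 := by
      intro h1
      have h2 := pow_eq_one_of_mulChar_eq_one h1
      rw [hψ] at h2
      obtain ⟨g, hg⟩ := IsCyclic.exists_generator (α := Fˣ)
      obtain ⟨k, hk⟩ := (mem_powers_iff_mem_zpowers.2 (hg (Units.mk0 x hx)))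
      simp only at hk
      have hxk : x = ((g ^ k : Fˣ) : F) := by rw [hk, Units.val_mk0]
      have hd : 0 < (Fintype.card F - 1) / l :=
        Nat.div_pos (Nat.le_of_dvd (Nat.sub_pos_of_lt Fintype.one_lt_card) hlF) hl.pos
      have hg1 : orderOf g = Fintype.card F - 1 := by
        rw [orderOf_eq_card_of_forall_mem_zpowers hg, Nat.card_eq_fintype_card,
          Fintype.card_units]
      rw [hxk, ← Units.val_pow_eq_pow_val, Units.val_eq_one, ← pow_mul,
        ← orderOf_dvd_iff_pow_eq_one, hg1] at h2
      nth_rw 1 [← Nat.mul_div_cancel' hlF] at h2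
      obtain ⟨m, rfl⟩ := Nat.dvd_of_mul_dvd_mul_right hd h2
      exact h ⟨((g ^ m : Fˣ) : F), by rw [hxk, mul_comm, pow_mul, Units.val_pow_eq_pow_val]⟩
    rw [geom_sum_eq h1, hpow, sub_self, zero_div]

lemma efree_iff {F : Type*} [Field F] {e : ℕ} (he : e ≠ 0) {x : F} :
    EFree e x ↔ x ≠ 0 ∧ ∀ l ∈ e.primeFactors, ¬ ∃ h, x = h ^ l := by
  refine and_congr_right fun _ => ⟨fun h l hl => ?_, fun h y d hd hy => ?_⟩
  · rintro ⟨y, hy⟩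
    exact (Nat.prime_of_mem_primeFactors hl).ne_one (h y l (Nat.dvd_of_mem_primeFactors hl) hy)
  · by_contra hd1
    obtain ⟨l, hl, m, rfl⟩ := Nat.exists_prime_and_dvd hd1
    exact h l (Nat.mem_primeFactors.2 ⟨hl, (Dvd.intro _ rfl).trans hd, he⟩)
      ⟨y ^ m, by rw [hy, ← pow_mul, mul_comm]⟩

open Classical in
lemma isCharCombination_not_pow_sub {F : Type*} [Field F] [Fintype F] {l : ℕ} (hl : l.Prime)
    (hlF : l ∣ Fintype.card F - 1) : IsCharCombination {χ | χ ≠ 1 ∧ χ ^ l = 1} (1 - 1 / (l : ℝ))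
      (fun x : F => if x = 0 then 0 else
        (if ∃ h, x = h ^ l then 0 else 1) - (1 - 1 / (l : ℂ))) := by
  obtain ⟨ψ, hψ, hsum⟩ := sum_mulChar_pow_eq hl hlF
  have hl0 : (l : ℂ) ≠ 0 := Nat.cast_ne_zero.2 hl.ne_zero
  refine ⟨Fin (l - 1), inferInstance, fun _ => -(1 / (l : ℂ)), fun k => ψ ^ ((k : ℕ) + 1),
    fun k => ⟨fun h => ?_, ?_⟩, le_of_eq ?_, fun x => ?_⟩
  · have := Nat.le_of_dvd k.val.succ_pos (orderOf_dvd_of_pow_eq_one h)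
    omega
  · rw [← pow_mul, mul_comm, pow_mul, orderOf_dvd_iff_pow_eq_one.1 hψ.dvd, one_pow]
  · have : (l : ℝ) ≠ 0 := Nat.cast_ne_zero.2 hl.ne_zero
    simp [Nat.cast_sub hl.one_le]
    field_simp
  · dsimp only
    split_ifs with hx h
    · simp [hx, MulChar.map_zero]
    all_goals
      have h1 := hsum x hx
      rw [← Nat.sub_add_cancel hl.one_le, sum_range_succ', Nat.sub_add_cancel hl.one_le,
        pow_zero, ← Units.val_mk0 hx, MulChar.one_apply_coe, Units.val_mk0, ← eq_sub_iff_add_eq]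
        at h1
      rw [← mul_sum, Fin.sum_univ_eq_sum_range (fun k => (ψ ^ (k + 1)) x), h1]
      simp only [h, if_true, if_false]
      field_simp
      ring

open Classical in
lemma isCharCombination_not_pow {F : Type*} [Field F] [Fintype F] {l : ℕ} (hl : l.Prime)
    (hlF : l ∣ Fintype.card F - 1) : IsCharCombination {χ | χ ^ l = 1} ((1 - 1 / (l : ℝ)) * 2)
      (fun x : F => if x ≠ 0 ∧ ¬ ∃ h, x = h ^ l then 1 else 0) := by
  obtain ⟨T, _, a, χ, hm, hB, hφ⟩ := isCharCombination_not_pow_sub hl hlF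
  have hl1 : 1 / (l : ℝ) ≤ 1 := by
    rw [one_div]
    exact inv_le_one_of_one_le₀ (by exact_mod_cast hl.one_le)
  refine ⟨Option T, inferInstance, fun t => t.elim ((1 - 1 / (l : ℝ) : ℝ) : ℂ) a,
    fun t => t.elim 1 χ, fun t => ?_, ?_, fun x => ?_⟩
  · cases t with
    | none => exact one_pow l
    | some t => exact (hm t).2
  · rw [Fintype.sum_option]
    simp only [Option.elim]
    rw [Complex.norm_real, Real.norm_of_nonneg (sub_nonneg.2 hl1)]
    linarith
  · rw [Fintype.sum_option]
    simp only [Option.elim]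
    rw [← hφ]
    dsimp only
    by_cases hx : x = 0
    · simp [hx, MulChar.map_zero]
    · have : (1 : MulChar F ℂ) x = 1 := MulChar.one_apply (Ne.isUnit hx)
      rw [this, if_neg hx]
      by_cases h : ∃ h, x = h ^ l <;> simp [h, hx]

open Classical in
lemma isCharCombination_efree {F : Type*} [Field F] [Fintype F] {e : ℕ}
    (he : e ∣ Fintype.card F - 1) : IsCharCombination {χ | χ ^ e = 1} (theta e * W e)
      (fun x : F => if EFree e x then 1 else 0) := by
  have he0 : e ≠ 0 := by
    rintro rfl
    have := Fintype.one_lt_card (α := F)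
    rw [zero_dvd_iff] at he
    omega
  have key : ∀ s : Finset ℕ, s ⊆ e.primeFactors →
      IsCharCombination {χ | χ ^ e = 1} (∏ l ∈ s, ((1 - 1 / (l : ℝ)) * 2))
        (fun x : F => if x ≠ 0 ∧ ∀ l ∈ s, ¬ ∃ h, x = h ^ l then 1 else 0) := by
    intro s
    induction s using Finset.induction_on with
    | empty =>
      intro _
      refine ⟨Unit, inferInstance, fun _ => 1, fun _ => 1, fun _ => one_pow e, by simp,
        fun x => ?_⟩
      by_cases hx : x = 0
      · simp [hx, MulChar.map_zero]
      · simp [hx, MulChar.one_apply (Ne.isUnit hx)]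
    | insert l s hls ih =>
      intro hs
      rw [insert_subset_iff] at hs
      have hl := hs.1
      have hle := Nat.dvd_of_mem_primeFactors hl
      rw [prod_insert hls]
      convert (isCharCombination_not_pow (Nat.prime_of_mem_primeFactors hl)
        (hle.trans he)).mul (ih hs.2) (S := {χ | χ ^ e = 1}) ?_ using 2 with x
      · rw [ite_zero_mul_ite_zero, mul_one]
        simp only [forall_mem_insert]
        congr 1
        exact propext ⟨fun h => ⟨⟨h.1, h.2.1⟩, h.1, h.2.2⟩, fun h => ⟨h.1.1, h.1.2, h.2.2⟩⟩
      · rintro χ₁ h₁ χ₂ h₂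
        obtain ⟨m, rfl⟩ := hle
        change χ₁ ^ l = 1 at h₁
        change χ₂ ^ (l * m) = 1 at h₂
        change (χ₁ * χ₂) ^ (l * m) = 1
        rw [mul_pow, h₂, pow_mul, h₁, one_pow, one_mul]
  have := key _ Subset.rfl
  simp_rw [← efree_iff he0] at this
  rwa [prod_mul_distrib, prod_const, ← theta, ← Nat.cast_two, ← Nat.cast_pow, ← W] at this

open Classical in
lemma isCharCombination_efree_mul_sub {F : Type*} [Field F] [Fintype F] {e l : ℕ}
    (he : e ∣ Fintype.card F - 1) (hl : l.Prime) (hlF : l ∣ Fintype.card F - 1)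
    (hle : ¬ l ∣ e) :
    IsCharCombination {χ | χ ≠ 1} ((1 - 1 / (l : ℝ)) * (theta e * W e))
      (fun x : F => (if EFree (l * e) x then 1 else 0) -
        (1 - 1 / (l : ℂ)) * if EFree e x then 1 else 0) := by
  have he0 : e ≠ 0 := by
    rintro rfl
    exact hle (dvd_zero l)
  have hcop : l.Coprime e := hl.coprime_iff_not_dvd.2 hle
  convert (isCharCombination_not_pow_sub hl hlF).mul (isCharCombination_efree he)
    (S := {χ | χ ≠ 1}) ?_ using 2 with x
  · have : EFree (l * e) x ↔ EFree e x ∧ ¬ ∃ h, x = h ^ l := by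
      rw [efree_iff he0, efree_iff (mul_ne_zero hl.ne_zero he0), hcop.primeFactors_mul,
        hl.primeFactors]
      simp only [mem_union, mem_singleton, or_imp, forall_and, forall_eq]
      tauto
    by_cases hx : EFree e x
    · by_cases h : ∃ h, x = h ^ l <;> simp [this, hx, h, hx.1]
    · simp [this, hx]
  · rintro χ₁ ⟨h₁, h₁'⟩ χ₂ h₂ h
    change χ₂ ^ e = 1 at h₂
    have h3 : χ₁ ^ e = 1 := by
      have : (χ₁ * χ₂) ^ e = 1 := by rw [h, one_pow]
      rwa [mul_pow, h₂, mul_one] at this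
    exact h₁ (by simpa [hcop] using pow_gcd_eq_one.2 ⟨h₁', h3⟩)

open Classical in
lemma Ncount_eq_sum {F : Type*} [Field F] [Fintype F] (n : ℕ) (e : Fin n → ℕ) :
    (Ncount F n e : ℂ) =
      ∑ x : F, ∏ k : Fin n, if EFree (e k) (x + ((k : ℕ) : F)) then 1 else 0 := by
  rw [Ncount, Nat.card_eq_fintype_card, Fintype.card_subtype, ← sum_boole]
  exact sum_congr rfl fun x _ => by simp [prod_ite_zero]

end CharacterCombinations

/-- For `3 ≤ n ≤ p`, `e ∣ q-1` and a prime `l ∣ q-1` with `l ∤ e`, for each `j`,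
`|N(l_{j1}e, …, l_{jn}e) - θ(l) N_n(e)| ≤ (1 - 1/l) θ(e)^n (n-1) W(e)^n √q`,
where `l_{jk} = l` if `j = k` and `l_{jk} = 1` otherwise. -/
theorem Ncount_sub_theta_Nn_abs_le (q p n : ℕ) (hq : IsPrimePow q)
    (F : Type*) [Field F] [Fintype F] (hF : Fintype.card F = q) (hp : CharP F p)
    (hn3 : 3 ≤ n) (hnp : n ≤ p) (e l : ℕ) (he : e ∣ q - 1)
    (hl : l.Prime) (hlq : l ∣ q - 1) (hle : ¬ l ∣ e) (j : Fin n) :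
    |(Ncount F n (fun k => (if j = k then l else 1) * e) : ℝ) - theta l * (Nn F n e : ℝ)| ≤
      (1 - 1 / (l : ℝ)) * theta e ^ n * ((n : ℝ) - 1) * (W e : ℝ) ^ n * Real.sqrt q := by
  classical
  subst hF
  have hb : Function.Injective (fun k : Fin n => ((k : ℕ) : F)) := fun a b hab =>
    Fin.ext ((CharP.natCast_injOn_Iio F p) (a.2.trans_le hnp) (b.2.trans_le hnp) hab)
  let f : ℕ → F → ℂ := fun m x => if EFree m x then 1 else 0
  let φ : Fin n → F → ℂ := fun k x =>
    if j = k then f (l * e) x - (1 - 1 / (l : ℂ)) * f e x else f e x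
  let S : Fin n → Set (MulChar F ℂ) := fun k => if j = k then {χ | χ ≠ 1} else {χ | χ ^ e = 1}
  let B : Fin n → ℝ := fun k => (if j = k then 1 - 1 / (l : ℝ) else 1) * (theta e * W e)
  have hcomb : ∀ k, IsCharCombination (S k) (B k) (φ k) := by
    intro k
    by_cases hk : j = k
    · simpa only [S, B, φ, f, if_pos hk] using isCharCombination_efree_mul_sub he hl hlq hle
    · simpa only [S, B, φ, f, if_neg hk, one_mul] using isCharCombination_efree he
  have hmain := norm_sum_prod_isCharCombination_le hcomb (j := j) (by simp [S]) hb
  have hB : ∏ k, B k = (1 - 1 / (l : ℝ)) * (theta e * W e) ^ n := by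
    simp only [B, prod_mul_distrib, prod_const, card_univ, Fintype.card_fin]
    rw [Fintype.prod_ite_eq, mul_pow]
  have htheta : theta l = 1 - 1 / (l : ℝ) := by
    rw [theta, hl.primeFactors, prod_singleton]
  have hsum : ((((Ncount F n (fun k => (if j = k then l else 1) * e) : ℝ) -
      theta l * (Nn F n e : ℝ) : ℝ)) : ℂ) = ∑ x : F, ∏ k, φ k (x + ((k : ℕ) : F)) := by
    rw [htheta]
    push_cast
    rw [Nn, Ncount_eq_sum, Ncount_eq_sum, mul_sum, ← sum_sub_distrib]
    refine sum_congr rfl fun x _ => ?_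
    rw [← mul_prod_erase univ _ (mem_univ j), ← mul_prod_erase univ (fun k : Fin n =>
      if EFree e (x + ((k : ℕ) : F)) then (1 : ℂ) else 0) (mem_univ j),
      ← mul_prod_erase univ (fun k => φ k _) (mem_univ j)]
    have h1 : ∀ k ∈ univ.erase j, φ k (x + ((k : ℕ) : F)) =
        if EFree e (x + ((k : ℕ) : F)) then 1 else 0 := fun k hk => by
      simp only [φ, f, if_neg (ne_of_mem_erase hk).symm]
    have h2 : ∀ k ∈ univ.erase j, (if EFree ((if j = k then l else 1) * e)
        (x + ((k : ℕ) : F)) then (1 : ℂ) else 0) =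
        if EFree e (x + ((k : ℕ) : F)) then 1 else 0 := fun k hk => by
      rw [if_neg (ne_of_mem_erase hk).symm, one_mul]
    rw [prod_congr rfl h1, prod_congr rfl h2]
    simp only [φ, f, if_true]
    ring
  rw [← Real.norm_eq_abs, ← Complex.norm_real, hsum]
  refine hmain.trans_eq ?_
  rw [hB, Fintype.card_fin, mul_pow]
  ring
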